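/- The even hyperbolic lattice U ⊕ E₈ ⊕ E₈ ⊕ A₁ ⊕ A₁ (the 2-elementary lattice with invariants (r,a,δ) = (20,2,1)) is reflective: the subgroup W_r of O(S) generated by reflections in all roots has finite index in O(S). -/

import Mathlib

open Matrix

/-- The bilinear form on `ℤⁿ` associated to a Gram matrix `G`. -/
def bform {n : ℕ} (G : Matrix (Fin n) (Fin n) ℤ) (x y : Fin n → ℤ) : ℤ :=
  x ⬝ᵥ G.mulVec y

/-- The orthogonal group `O(S)` of the lattice with Gram matrix `G`:
all `ℤ`-module automorphisms preserving the bilinear form. -/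
def OrthGroup (n : ℕ) (G : Matrix (Fin n) (Fin n) ℤ) :
    Subgroup ((Fin n → ℤ) ≃ₗ[ℤ] (Fin n → ℤ)) where
  carrier := {f | ∀ x y, bform G (f x) (f y) = bform G x y}
  one_mem' := fun _ _ => rfl
  mul_mem' := by
    intro f g hf hg x y
    exact (hf (g x) (g y)).trans (hg x y)
  inv_mem' := by
    intro f hf x y
    have h := (hf (f⁻¹ x) (f⁻¹ y)).symm
    rwa [show f (f⁻¹ x) = x from f.apply_symm_apply x,
      show f (f⁻¹ y) = y from f.apply_symm_apply y] at h

/-- A root: a vector of square `-2`, or of square `-4` whose pairing with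
the whole lattice is even. -/
def IsRoot {n : ℕ} (G : Matrix (Fin n) (Fin n) ℤ) (α : Fin n → ℤ) : Prop :=
  bform G α α = -2 ∨ (bform G α α = -4 ∧ ∀ x : Fin n → ℤ, (2 : ℤ) ∣ bform G α x)

/-- `f` is the reflection in a root `α`. -/
def IsReflection {n : ℕ} (G : Matrix (Fin n) (Fin n) ℤ)
    (f : (Fin n → ℤ) ≃ₗ[ℤ] (Fin n → ℤ)) : Prop :=
  ∃ α : Fin n → ℤ, IsRoot G α ∧
    ∀ x : Fin n → ℤ, f x = x - ((2 * bform G x α) / bform G α α) • α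

/-- The subgroup `W_r` of `O(S)` generated by the reflections in all roots. -/
def Wr (n : ℕ) (G : Matrix (Fin n) (Fin n) ℤ) : Subgroup ↥(OrthGroup n G) :=
  Subgroup.closure {f | IsReflection G f.val}

open Matrix

/-- Orthogonal direct sum of two Gram matrices. -/
def dsum {m k : ℕ} (A : Matrix (Fin m) (Fin m) ℤ) (B : Matrix (Fin k) (Fin k) ℤ) :
    Matrix (Fin (m + k)) (Fin (m + k)) ℤ :=
  Matrix.reindex finSumFinEquiv finSumFinEquiv (Matrix.fromBlocks A 0 0 B)

/-- Gram matrix of the hyperbolic plane `U`. -/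
def gramU : Matrix (Fin 2) (Fin 2) ℤ := !![0, 1; 1, 0]

/-- Gram matrix of `A₁ = ⟨-2⟩`. -/
def gramA1 : Matrix (Fin 1) (Fin 1) ℤ := !![-2]

/-- Gram matrix (= negative Cartan matrix) of a simply laced root lattice with
given Dynkin diagram edges. -/
def adjGram (n : ℕ) (E : List (ℕ × ℕ)) : Matrix (Fin n) (Fin n) ℤ :=
  Matrix.of fun i j =>
    if i = j then -2 else if (i.1, j.1) ∈ E ∨ (j.1, i.1) ∈ E then 1 else 0

/-- Gram matrix of the negative definite root lattice `Dₙ`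
(in the root basis `e₁+e₂, e₂-e₁, e₃-e₂, …, eₙ-eₙ₋₁` of `{x ∈ ℤⁿ : Σxᵢ even}`
with the negative of the standard Euclidean form). -/
def gramD (n : ℕ) : Matrix (Fin n) (Fin n) ℤ :=
  adjGram n ((0, 2) :: (List.range (n - 2)).map fun k => (k + 1, k + 2))

/-- Gram matrix (negative Cartan matrix) of `E₈`. -/
def gramE8 : Matrix (Fin 8) (Fin 8) ℤ :=
  adjGram 8 [(0, 2), (1, 3), (2, 3), (3, 4), (4, 5), (5, 6), (6, 7)]

/-- Gram matrix (negative Cartan matrix) of `E₇`. -/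
def gramE7 : Matrix (Fin 7) (Fin 7) ℤ :=
  adjGram 7 [(0, 2), (1, 3), (2, 3), (3, 4), (4, 5), (5, 6)]

/-- The Gram matrix of the even 2-elementary hyperbolic lattice `U ⊕ E₈ ⊕ E₈ ⊕ A₁ ⊕ A₁`,
with invariants `(r,a,δ) = (20,2,1)`. -/
def gramS :=
  dsum gramU (dsum gramE8 (dsum gramE8 (dsum gramA1 gramA1)))

section LorentzianReflections

/-- The standard bilinear form of signature `(1, m)`. -/
def lorentz {m : ℕ} (u v : Fin (m + 1) → ℤ) : ℤ :=
  u 0 * v 0 - ∑ i : Fin m, u i.succ * v i.succ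

section Lorentz

variable {m : ℕ} {u v : Fin (m + 1) → ℤ}

theorem lorentz_comm (u v : Fin (m + 1) → ℤ) : lorentz u v = lorentz v u := by
  simp only [lorentz, mul_comm]

theorem sq_time_sub_lorentz_le (u v : Fin (m + 1) → ℤ) :
    (u 0 * v 0 - lorentz u v) ^ 2 ≤
      (u 0 ^ 2 - lorentz u u) * (v 0 ^ 2 - lorentz v v) := by
  have h := Finset.sum_mul_sq_le_sq_mul_sq Finset.univ (fun i : Fin m => u i.succ)
    fun i => v i.succ
  simpa [lorentz, pow_two] using h

theorem time_sq_sub_lorentz_nonneg (u : Fin (m + 1) → ℤ) : 0 ≤ u 0 ^ 2 - lorentz u u := by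
  have h : 0 ≤ ∑ i : Fin m, u i.succ * u i.succ :=
    Finset.sum_nonneg fun i _ => mul_self_nonneg _
  simpa [lorentz, pow_two] using h

theorem lorentz_pos_iff (hu : 0 < lorentz u u) (hv : 0 < lorentz v v) :
    0 < lorentz u v ↔ 0 < u 0 * v 0 := by
  have h := sq_time_sub_lorentz_le u v
  have hu' := time_sq_sub_lorentz_nonneg u
  have hv' := time_sq_sub_lorentz_nonneg v
  have hlt : (u 0 * v 0 - lorentz u v) ^ 2 < (u 0 * v 0) ^ 2 := by nlinarith
  constructor <;> intro h0 <;> by_contra h1 <;> nlinarith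

theorem lorentz_ne_zero (hu : 0 < lorentz u u) (hv : 0 < lorentz v v) :
    lorentz u v ≠ 0 := by
  intro h0
  have h := sq_time_sub_lorentz_le u v
  have hu' := time_sq_sub_lorentz_nonneg u
  have hv' := time_sq_sub_lorentz_nonneg v
  rw [h0] at h
  nlinarith

theorem lorentz_pos_trans {w : Fin (m + 1) → ℤ} (hu : 0 < lorentz u u)
    (hv : 0 < lorentz v v) (hw : 0 < lorentz w w) (huv : 0 < lorentz u v)
    (hvw : 0 < lorentz v w) : 0 < lorentz u w := by
  rw [lorentz_pos_iff hu hv] at huv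
  rw [lorentz_pos_iff hv hw] at hvw
  rw [lorentz_pos_iff hu hw]
  by_contra h
  nlinarith [mul_pos huv hvw, sq_nonneg (v 0)]

theorem eq_zero_of_lorentz_eq_zero (hu : 0 < lorentz u u) (hv : 0 ≤ lorentz v v)
    (huv : lorentz u v = 0) : v = 0 := by
  have h := sq_time_sub_lorentz_le u v
  have hu' := time_sq_sub_lorentz_nonneg u
  have hv' := time_sq_sub_lorentz_nonneg v
  have h0 : v 0 = 0 := by
    by_contra hne
    have : 0 < v 0 ^ 2 := by positivity
    rw [huv] at h
    nlinarith
  have hs : ∑ i : Fin m, v i.succ * v i.succ = 0 := by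
    refine le_antisymm ?_ (Finset.sum_nonneg fun i _ => mul_self_nonneg _)
    have := hv
    rw [lorentz, h0] at this
    linarith
  rw [Finset.sum_eq_zero_iff_of_nonneg fun i _ => mul_self_nonneg _] at hs
  funext i
  refine Fin.cases h0 (fun i => ?_) i
  simpa using hs i (Finset.mem_univ i)

/-- Vectors of given square and given product with a fixed positive vector are bounded. -/
theorem exists_abs_le_of_lorentz_eq (hv : 0 < lorentz v v) (c d : ℤ) :
    ∃ K : ℤ, ∀ u : Fin (m + 1) → ℤ, lorentz u u = c → lorentz v u = d → ∀ i, |u i| ≤ K := by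
  set A := |c * (v 0 ^ 2 - lorentz v v) + d ^ 2| with hA
  set T := 2 * |d * v 0| + A + 1 with hT
  refine ⟨T ^ 2 + |c| + T, fun u huc hud i => ?_⟩
  have hT0 : 0 < T := by positivity
  have ht : |u 0| ≤ T := by
    have h := sq_time_sub_lorentz_le v u
    rw [hud, huc] at h
    have h1 : lorentz v v * u 0 ^ 2 ≤ 2 * (d * v 0) * u 0 + A := by
      have h2 := neg_abs_le (c * (v 0 ^ 2 - lorentz v v) + d ^ 2)
      nlinarith
    have h3 : d * v 0 * u 0 ≤ |d * v 0| * |u 0| := by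
      rw [← abs_mul]; exact le_abs_self _
    have h4 : |u 0| ^ 2 ≤ 2 * (|d * v 0| * |u 0|) + A := by
      rw [sq_abs]; nlinarith [sq_nonneg (u 0)]
    by_contra! hlt
    have hA0 : 0 ≤ A := abs_nonneg _
    have hd0 : 0 ≤ |d * v 0| := abs_nonneg _
    nlinarith
  refine Fin.cases ?_ (fun i => ?_) i
  · nlinarith [abs_nonneg c, sq_nonneg T]
  · have hi : u i.succ * u i.succ ≤ ∑ j : Fin m, u j.succ * u j.succ :=
      Finset.single_le_sum (f := fun j : Fin m => u j.succ * u j.succ)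
        (fun j _ => mul_self_nonneg _) (Finset.mem_univ i)
    have hs : ∑ j : Fin m, u j.succ * u j.succ = u 0 ^ 2 - c := by
      rw [← huc, lorentz]; ring
    have h1 : u 0 ^ 2 ≤ T ^ 2 := by
      rw [← sq_abs]; exact pow_le_pow_left₀ (abs_nonneg _) ht 2
    have h2 : |u i.succ| ≤ u i.succ * u i.succ := by
      rw [← abs_mul_abs_self]
      rcases (abs_nonneg (u i.succ)).eq_or_lt with h | h
      · rw [← h]; norm_num
      · nlinarith
    linarith [neg_abs_le c]

end Lorentz

variable {n m : ℕ} {G : Matrix (Fin n) (Fin n) ℤ}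

theorem bform_sub_left (x y z : Fin n → ℤ) :
    bform G (x - y) z = bform G x z - bform G y z := by
  simp [bform, sub_dotProduct]

theorem bform_sub_right (x y z : Fin n → ℤ) :
    bform G x (y - z) = bform G x y - bform G x z := by
  simp [bform, Matrix.mulVec_sub, dotProduct_sub]

theorem bform_add_left (x y z : Fin n → ℤ) :
    bform G (x + y) z = bform G x z + bform G y z := by
  simp [bform, add_dotProduct]

theorem bform_add_right (x y z : Fin n → ℤ) :
    bform G x (y + z) = bform G x y + bform G x z := by
  simp [bform, Matrix.mulVec_add, dotProduct_add]

theorem bform_smul_left (c : ℤ) (x y : Fin n → ℤ) :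
    bform G (c • x) y = c * bform G x y := by
  rw [bform, smul_dotProduct, smul_eq_mul, bform]

theorem bform_smul_right (c : ℤ) (x y : Fin n → ℤ) :
    bform G x (c • y) = c * bform G x y := by
  rw [bform, Matrix.mulVec_smul, dotProduct_smul, smul_eq_mul, bform]

theorem bform_neg_left (x y : Fin n → ℤ) : bform G (-x) y = -bform G x y := by
  simp [bform]

theorem bform_neg_right (x y : Fin n → ℤ) : bform G x (-y) = -bform G x y := by
  simp [bform, Matrix.mulVec_neg]

theorem IsRoot.neg {α : Fin n → ℤ} (hα : IsRoot G α) : bform G α α < 0 := by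
  rcases hα with h | ⟨h, -⟩ <;> omega

theorem IsRoot.dvd (hG : ∀ x y, bform G x y = bform G y x) {α : Fin n → ℤ}
    (hα : IsRoot G α) (x : Fin n → ℤ) : bform G α α ∣ 2 * bform G x α := by
  rcases hα with h | ⟨h, h2⟩
  · rw [h]; exact ⟨-bform G x α, by ring⟩
  · obtain ⟨k, hk⟩ := h2 x
    rw [h, hG, hk]; exact ⟨-k, by ring⟩

/-- The reflection in a root is an element of `W_r`. -/
theorem IsRoot.exists_reflection (hG : ∀ x y, bform G x y = bform G y x) {α : Fin n → ℤ}
    (hα : IsRoot G α) :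
    ∃ s ∈ Wr n G, ∀ x, s.1 x = x - ((2 * bform G x α) / bform G α α) • α := by
  have h0 : bform G α α ≠ 0 := hα.neg.ne
  let φ : (Fin n → ℤ) →ₗ[ℤ] ℤ :=
    { toFun := fun x => (2 * bform G x α) / bform G α α
      map_add' := fun x y => by
        rw [bform_add_left, mul_add, Int.add_ediv_of_dvd_left (hα.dvd hG x)]
      map_smul' := fun c x => by
        rw [bform_smul_left, mul_left_comm, Int.mul_ediv_assoc _ (hα.dvd hG x)]
        rfl }
  have hφ : ∀ x, φ x * bform G α α = 2 * bform G x α := fun x =>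
    Int.ediv_mul_cancel (hα.dvd hG x)
  have h2 : φ α = 2 := mul_right_cancel₀ h0 (hφ α)
  have hs : ∀ x, Module.reflection h2 x = x - φ x • α := fun x => Module.reflection_apply x h2
  refine ⟨⟨Module.reflection h2, fun x y => ?_⟩, Subgroup.subset_closure ⟨α, hα, hs⟩, hs⟩
  rw [hs, hs, bform_sub_left, bform_sub_right, bform_sub_right, bform_smul_left,
    bform_smul_left, bform_smul_right, bform_smul_right, hG α y]
  refine mul_left_cancel₀ two_ne_zero ?_
  linear_combination φ y * hφ x + φ x * hφ y

variable {E : Matrix (Fin (m + 1)) (Fin n) ℤ}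

theorem bform_comm (hG : ∀ x y, bform G x y = lorentz (E *ᵥ x) (E *ᵥ y)) (x y : Fin n → ℤ) :
    bform G x y = bform G y x := by
  rw [hG, hG, lorentz_comm]

theorem bform_pos_trans (hG : ∀ x y, bform G x y = lorentz (E *ᵥ x) (E *ᵥ y))
    {x y z : Fin n → ℤ} (hx : 0 < bform G x x) (hy : 0 < bform G y y) (hz : 0 < bform G z z)
    (hxy : 0 < bform G x y) (hyz : 0 < bform G y z) : 0 < bform G x z := by
  rw [hG] at *
  exact lorentz_pos_trans hx hy hz hxy hyz

theorem finite_setOf_bform_eq (hG : ∀ x y, bform G x y = lorentz (E *ᵥ x) (E *ᵥ y))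
    (hE : Function.Injective (E *ᵥ ·)) {v : Fin n → ℤ} (hv : 0 < bform G v v) (c d : ℤ) :
    {y | bform G y y = c ∧ bform G v y = d}.Finite := by
  rw [hG] at hv
  obtain ⟨K, hK⟩ := exists_abs_le_of_lorentz_eq hv c d
  refine ((Set.finite_Icc (fun _ => -K) fun _ => K).preimage hE.injOn).subset ?_
  rintro y ⟨hc, hd⟩
  rw [hG] at hc hd
  exact ⟨fun i => (abs_le.1 (hK _ hc hd i)).1, fun i => (abs_le.1 (hK _ hc hd i)).2⟩

/-- Finitely many isometries map a given positive vector to a given vector. -/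
theorem finite_setOf_apply_eq (hG : ∀ x y, bform G x y = lorentz (E *ᵥ x) (E *ᵥ y))
    (hE : Function.Injective (E *ᵥ ·)) {ρ : Fin n → ℤ} (hρ : 0 < bform G ρ ρ)
    (v : Fin n → ℤ) : {γ : OrthGroup n G | γ.1 ρ = v}.Finite := by
  by_cases hv : 0 < bform G v v
  · have hfin := Set.Finite.pi' fun j : Fin n =>
      finite_setOf_bform_eq hG hE hv (bform G (Pi.single j 1) (Pi.single j 1))
        (bform G ρ (Pi.single j 1))
    refine Set.Finite.of_finite_image (f := fun γ j => γ.1 (Pi.single j 1))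
      (hfin.subset ?_) fun γ _ δ _ h => ?_
    · rintro _ ⟨γ, rfl, rfl⟩ j
      exact ⟨γ.2 _ _, γ.2 _ _⟩
    · refine Subtype.ext (LinearEquiv.toLinearMap_injective ?_)
      refine LinearMap.pi_ext' fun j => LinearMap.ext_ring ?_
      exact congrFun h j
  · convert Set.finite_empty
    refine Set.eq_empty_of_forall_notMem fun γ hγ => hv ?_
    rw [← show γ.1 ρ = v from hγ, γ.2]
    exact hρ

variable {ι : Type*} {α : ι → Fin n → ℤ} {ρ : Fin n → ℤ}

/-- A vector in the positive cone can be moved by reflections into the chamber of the `α i`. -/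
theorem exists_mem_Wr_apply_mem_chamber
    (hG : ∀ x y, bform G x y = lorentz (E *ᵥ x) (E *ᵥ y)) (hα : ∀ i, IsRoot G (α i))
    (hρ : 0 < bform G ρ ρ) (hαρ : ∀ i, 0 < bform G (α i) ρ) (x : Fin n → ℤ)
    (hx : 0 < bform G x x) (hxρ : 0 < bform G x ρ) :
    ∃ w ∈ Wr n G, 0 < bform G (w.1 x) ρ ∧ ∀ i, 0 ≤ bform G (α i) (w.1 x) := by
  induction h : (bform G x ρ).toNat using Nat.strong_induction_on generalizing x with
  | _ N ih =>
    by_cases hP : ∀ i, 0 ≤ bform G (α i) x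
    · exact ⟨1, one_mem _, hxρ, hP⟩
    push Not at hP
    obtain ⟨i, hi⟩ := hP
    obtain ⟨s, hs, hsx⟩ := (hα i).exists_reflection (bform_comm hG)
    have hneg := (hα i).neg
    have hxi : bform G x (α i) < 0 := by rwa [bform_comm hG]
    set c := (2 * bform G x (α i)) / bform G (α i) (α i) with hc
    have hcm : c * bform G (α i) (α i) = 2 * bform G x (α i) :=
      Int.ediv_mul_cancel ((hα i).dvd (bform_comm hG) x)
    have hc0 : 0 < c := by nlinarith
    have hxs : 0 < bform G x (s.1 x) := by
      rw [hsx, bform_sub_right, bform_smul_right]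
      nlinarith
    have hss : 0 < bform G (s.1 x) (s.1 x) := by rwa [s.2]
    have hsρ : 0 < bform G (s.1 x) ρ :=
      bform_pos_trans hG hss hx hρ (by rwa [bform_comm hG]) hxρ
    have hlt : bform G (s.1 x) ρ < bform G x ρ := by
      rw [hsx, bform_sub_left, bform_smul_left]
      nlinarith [hαρ i]
    obtain ⟨w, hw, hwρ, hwP⟩ := ih _ (by omega) (s.1 x) hss hsρ rfl
    exact ⟨w * s, mul_mem hw hs, hwρ, hwP⟩

/-- The chamber contains finitely many vectors of a given positive square. -/
theorem finite_setOf_mem_chamber [Finite ι]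
    (hG : ∀ x y, bform G x y = lorentz (E *ᵥ x) (E *ᵥ y))
    (hE : Function.Injective (E *ᵥ ·)) (hρ : 0 < bform G ρ ρ)
    (hcop : ∀ y, (∀ i, 0 ≤ bform G (α i) y) → 0 ≤ bform G y y) {N : ℤ} (hN : 0 < N) :
    {x | bform G x x = N ∧ 0 < bform G x ρ ∧ ∀ i, 0 ≤ bform G (α i) x}.Finite := by
  by_contra hinf
  let f := Set.Infinite.natEmbedding _ hinf
  obtain ⟨a, b, hab, hle⟩ := wellQuasiOrdered_le
    fun k (i : ι) => (bform G (α i) (f k : Fin n → ℤ)).toNat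
  refine hab.ne (f.injective (Subtype.ext ?_))
  generalize f a = x at hle ⊢
  generalize f b = y at hle ⊢
  obtain ⟨x, hxN, hxρ, hxP⟩ := x
  obtain ⟨y, hyN, hyρ, hyP⟩ := y
  have hxy : 0 < bform G x y :=
    bform_pos_trans hG (hxN ▸ hN) hρ (hyN ▸ hN) hxρ (by rwa [bform_comm hG])
  have hle' : ∀ i, bform G (α i) x ≤ bform G (α i) y := fun i => by
    have := hle i
    have := hyP i
    simp only at *
    omega
  have hq : 0 ≤ bform G (y - x) (y - x) :=
    hcop _ fun i => by rw [bform_sub_right]; linarith [hle' i]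
  have hsum : 0 < bform G (x + y) (x + y) := by
    rw [bform_add_left, bform_add_right, bform_add_right, bform_comm hG y x]
    linarith
  have horth : bform G (x + y) (y - x) = 0 := by
    rw [bform_add_left, bform_sub_right, bform_sub_right, bform_comm hG y x]
    linarith
  rw [hG] at hq hsum horth
  have h0 := eq_zero_of_lorentz_eq_zero hsum hq horth
  have : y - x = 0 := hE (by simpa using h0)
  exact (sub_eq_zero.1 this).symm

/-- A Lorentzian lattice is reflective as soon as finitely many roots bound a chamber
contained in the closed light cone. -/
theorem finiteIndex_Wr [Finite ι] (hG : ∀ x y, bform G x y = lorentz (E *ᵥ x) (E *ᵥ y))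
    (hE : Function.Injective (E *ᵥ ·)) (hα : ∀ i, IsRoot G (α i)) (hρ : 0 < bform G ρ ρ)
    (hαρ : ∀ i, 0 < bform G (α i) ρ)
    (hcop : ∀ y, (∀ i, 0 ≤ bform G (α i) y) → 0 ≤ bform G y y) :
    (Wr n G).FiniteIndex := by
  have hF := finite_setOf_mem_chamber hG hE hρ hcop hρ
  set F := {x | bform G x x = bform G ρ ρ ∧ 0 < bform G x ρ ∧ ∀ i, 0 ≤ bform G (α i) x}
  set T := {τ : OrthGroup n G | ∃ v ∈ F ∪ -F, τ.1 ρ = v}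
  have hT : T.Finite := by
    have := (hF.union hF.neg).biUnion fun v _ => finite_setOf_apply_eq hG hE hρ v
    refine this.subset fun τ ⟨v, hv, h⟩ => Set.mem_biUnion hv h
  have hmem : ∀ γ : OrthGroup n G, ∃ w ∈ Wr n G, w * γ ∈ T := fun γ => by
    have hpos : 0 < bform G (γ.1 ρ) (γ.1 ρ) := by rwa [γ.2]
    have hne : bform G (γ.1 ρ) ρ ≠ 0 := by
      rw [hG] at hpos hρ ⊢
      exact lorentz_ne_zero hpos hρ
    rcases hne.lt_or_gt with hlt | hgt
    · obtain ⟨w, hw, h1, h2⟩ := exists_mem_Wr_apply_mem_chamber hG hα hρ hαρ (-γ.1 ρ)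
        (by rwa [bform_neg_left, bform_neg_right, neg_neg])
        (by rw [bform_neg_left]; linarith)
      refine ⟨w, hw, _, Or.inr ?_, rfl⟩
      rw [map_neg] at h1 h2
      refine ⟨?_, h1, h2⟩
      rw [bform_neg_left, bform_neg_right, neg_neg]
      exact (w * γ).2 ρ ρ
    · obtain ⟨w, hw, h1, h2⟩ := exists_mem_Wr_apply_mem_chamber hG hα hρ hαρ (γ.1 ρ) hpos hgt
      exact ⟨w, hw, _, Or.inl ⟨(w * γ).2 ρ ρ, h1, h2⟩, rfl⟩
  have : Finite T := hT
  have : Finite (OrthGroup n G ⧸ Wr n G) := by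
    refine Finite.of_surjective (fun τ : T => (QuotientGroup.mk τ.1⁻¹ : OrthGroup n G ⧸ Wr n G))
      fun q => ?_
    induction q using QuotientGroup.induction_on with
    | H γ =>
      obtain ⟨w, hw, h⟩ := hmem γ⁻¹
      refine ⟨⟨_, h⟩, QuotientGroup.eq.2 ?_⟩
      simpa [mul_assoc] using hw
  exact Subgroup.finiteIndex_of_finite_quotient

end LorentzianReflections

set_option maxRecDepth 100000

/-- The linear form with coefficient list `f`, evaluated at `u`. -/
def evalForm : List ℤ → (ℕ → ℤ) → ℤ
  | [], _ => 0
  | a :: f, u => a * u 0 + evalForm f fun i => u (i + 1)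

/-- Sum of coefficient lists, the shorter one being padded by zeros. -/
def addForm : List ℤ → List ℤ → List ℤ
  | [], g => g
  | a :: f, [] => a :: f
  | a :: f, b :: g => (a + b) :: addForm f g

/-- Multiple of a coefficient list. -/
def smulForm (c : ℤ) : List ℤ → List ℤ
  | [] => []
  | a :: f => (c * a) :: smulForm c f

/-- The quadratic form whose upper triangular coefficients are the rows of `Q`,
evaluated at `u`. -/
def evalQuad : List (List ℤ) → (ℕ → ℤ) → ℤ
  | [], _ => 0
  | f :: Q, u => u 0 * evalForm f u + evalQuad Q fun i => u (i + 1)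

/-- Sum of upper triangular coefficient tables. -/
def addQuad : List (List ℤ) → List (List ℤ) → List (List ℤ)
  | [], Q => Q
  | f :: P, [] => f :: P
  | f :: P, g :: Q => addForm f g :: addQuad P Q

/-- Upper triangular coefficients of a product of two linear forms. -/
def mulForm : List ℤ → List ℤ → List (List ℤ)
  | a :: f, b :: g =>
    (a * b :: addForm (smulForm b f) (smulForm a g)) :: mulForm f g
  | _, _ => []

/-- Upper triangular coefficients of a sum of products of linear forms. -/
def expandProducts : List (List ℤ × List ℤ) → List (List ℤ)
  | [] => []
  | p :: E => addQuad (mulForm p.1 p.2) (expandProducts E)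

/-- The linear form `f` composed with the substitution whose rows are the forms in `A`. -/
def compForm : List ℤ → List (List ℤ) → List ℤ
  | a :: f, r :: A => if a = 0 then compForm f A else addForm (smulForm a r) (compForm f A)
  | _, _ => []

/-- The linear form `⟨v, ·⟩` of the standard Lorentzian form of signature `(1, *)`. -/
def lorentzForm : List ℤ → List ℤ
  | [] => []
  | a :: v => a :: v.map fun x => -x

/-- The combination of the linear forms in `F` with the given indices and coefficients. -/
def combForm (F : List (List ℤ)) : List (ℕ × ℕ) → List ℤ
  | [] => []
  | t :: T => addForm (smulForm t.2 (F.getD t.1 [])) (combForm F T)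

/-- Chart of the chamber near an ideal vertex. -/
structure CuspChart where
  /-- the size of the horosphere -/
  weight : ℕ
  /-- a common multiple of all weights, divided by `weight` -/
  coweight : ℕ
  /-- the ideal vertex as a combination of simple roots -/
  decomposition : List (ℕ × ℕ)
  /-- the cusps whose horospheres are compared to that of `cusp`: the index of their
  chart, and a word in the generating chamber symmetries -/
  neighbours : List (ℕ × List ℕ)
  /-- the multiple of the quadratic form that is decomposed by `certificate` -/
  scale : ℕ
  /-- coefficients of a decomposition of the quadratic form into products of
  nonnegative linear forms -/
  certificate : List (ℕ × List (ℕ × ℕ))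

/-- The fifty simple roots of the Vinberg chamber, as vectors of `ℤ^{1,19}`. -/
def simpleRoots : List (List ℤ) :=
  [[0, -1, 1, 0, 0, 0, 0, 0, 0, 0, 0, 0, 0, 0, 0, 0, 0, 0, 0, 0],
   [0, 0, -1, 1, 0, 0, 0, 0, 0, 0, 0, 0, 0, 0, 0, 0, 0, 0, 0, 0],
   [0, 0, 0, -1, 1, 0, 0, 0, 0, 0, 0, 0, 0, 0, 0, 0, 0, 0, 0, 0],
   [0, 0, 0, 0, -1, 1, 0, 0, 0, 0, 0, 0, 0, 0, 0, 0, 0, 0, 0, 0],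
   [0, 0, 0, 0, 0, -1, 1, 0, 0, 0, 0, 0, 0, 0, 0, 0, 0, 0, 0, 0],
   [0, 0, 0, 0, 0, 0, -1, 1, 0, 0, 0, 0, 0, 0, 0, 0, 0, 0, 0, 0],
   [0, 0, 0, 0, 0, 0, 0, -1, 1, 0, 0, 0, 0, 0, 0, 0, 0, 0, 0, 0],
   [0, 0, 0, 0, 0, 0, 0, 0, -1, 1, 0, 0, 0, 0, 0, 0, 0, 0, 0, 0],
   [0, 0, 0, 0, 0, 0, 0, 0, 0, -1, 1, 0, 0, 0, 0, 0, 0, 0, 0, 0],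
   [0, 0, 0, 0, 0, 0, 0, 0, 0, 0, -1, 1, 0, 0, 0, 0, 0, 0, 0, 0],
   [0, 0, 0, 0, 0, 0, 0, 0, 0, 0, 0, -1, 1, 0, 0, 0, 0, 0, 0, 0],
   [0, 0, 0, 0, 0, 0, 0, 0, 0, 0, 0, 0, -1, 1, 0, 0, 0, 0, 0, 0],
   [0, 0, 0, 0, 0, 0, 0, 0, 0, 0, 0, 0, 0, -1, 1, 0, 0, 0, 0, 0],
   [0, 0, 0, 0, 0, 0, 0, 0, 0, 0, 0, 0, 0, 0, -1, 1, 0, 0, 0, 0],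
   [0, 0, 0, 0, 0, 0, 0, 0, 0, 0, 0, 0, 0, 0, 0, -1, 1, 0, 0, 0],
   [0, 0, 0, 0, 0, 0, 0, 0, 0, 0, 0, 0, 0, 0, 0, 0, -1, 1, 0, 0],
   [0, 0, 0, 0, 0, 0, 0, 0, 0, 0, 0, 0, 0, 0, 0, 0, 0, -1, 1, 0],
   [0, 0, 0, 0, 0, 0, 0, 0, 0, 0, 0, 0, 0, 0, 0, 0, 0, 0, -1, 1],
   [0, 0, 0, 0, 0, 0, 0, 0, 0, 0, 0, 0, 0, 0, 0, 0, 0, 0, 0, -1],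
   [1, 1, 1, 1, 0, 0, 0, 0, 0, 0, 0, 0, 0, 0, 0, 0, 0, 0, 0, 0],
   [3, 1, 1, 1, 1, 1, 1, 1, 1, 1, 1, 1, 0, 0, 0, 0, 0, 0, 0, 0],
   [4, 2, 1, 1, 1, 1, 1, 1, 1, 1, 1, 1, 1, 1, 1, 1, 0, 0, 0, 0],
   [4, 1, 1, 1, 1, 1, 1, 1, 1, 1, 1, 1, 1, 1, 1, 1, 1, 1, 1, 0],
   [5, 3, 1, 1, 1, 1, 1, 1, 1, 1, 1, 1, 1, 1, 1, 1, 1, 1, 1, 1],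
   [6, 2, 2, 2, 2, 2, 2, 2, 1, 1, 1, 1, 1, 1, 1, 1, 1, 1, 0, 0],
   [7, 3, 2, 2, 2, 2, 2, 2, 2, 2, 1, 1, 1, 1, 1, 1, 1, 1, 1, 1],
   [6, 2, 2, 2, 2, 2, 2, 1, 1, 1, 1, 1, 1, 1, 1, 1, 1, 1, 1, 1],
   [9, 3, 3, 3, 3, 3, 3, 3, 3, 1, 1, 1, 1, 1, 1, 1, 1, 1, 1, 1],
   [9, 3, 3, 3, 3, 3, 2, 2, 2, 2, 2, 2, 2, 2, 1, 1, 1, 1, 1, 1],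
   [11, 3, 3, 3, 3, 3, 3, 3, 3, 3, 3, 3, 3, 3, 1, 1, 1, 1, 1, 1],
   [8, 3, 3, 2, 2, 2, 2, 2, 2, 2, 2, 2, 2, 1, 1, 1, 1, 1, 1, 1],
   [10, 3, 3, 3, 3, 3, 3, 3, 3, 2, 2, 2, 2, 2, 2, 1, 1, 1, 1, 1],
   [15, 5, 5, 5, 5, 5, 5, 3, 3, 3, 3, 3, 3, 3, 3, 1, 1, 1, 1, 1],
   [15, 5, 5, 5, 5, 5, 3, 3, 3, 3, 3, 3, 3, 3, 3, 3, 3, 1, 1, 1],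
   [12, 4, 4, 4, 4, 3, 3, 3, 3, 3, 3, 2, 2, 2, 2, 2, 2, 1, 1, 1],
   [17, 5, 5, 5, 5, 5, 5, 5, 5, 5, 3, 3, 3, 3, 3, 3, 3, 1, 1, 1],
   [19, 7, 7, 5, 5, 5, 5, 5, 5, 5, 5, 3, 3, 3, 3, 3, 3, 3, 1, 1],
   [21, 7, 7, 7, 7, 7, 5, 5, 5, 5, 5, 3, 3, 3, 3, 3, 3, 3, 3, 1],
   [21, 7, 7, 7, 7, 5, 5, 5, 5, 5, 5, 5, 5, 3, 3, 3, 3, 3, 1, 1],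
   [21, 7, 7, 7, 7, 5, 5, 5, 5, 5, 5, 5, 3, 3, 3, 3, 3, 3, 3, 3],
   [23, 9, 7, 7, 7, 7, 7, 5, 5, 5, 5, 5, 5, 3, 3, 3, 3, 3, 3, 1],
   [23, 7, 7, 7, 7, 7, 7, 7, 5, 5, 5, 5, 5, 3, 3, 3, 3, 3, 3, 3],
   [25, 9, 9, 7, 7, 7, 7, 7, 7, 5, 5, 5, 5, 5, 3, 3, 3, 3, 3, 1],
   [25, 9, 9, 7, 7, 7, 7, 7, 5, 5, 5, 5, 5, 5, 5, 3, 3, 3, 3, 3],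
   [27, 9, 9, 9, 9, 7, 7, 7, 7, 7, 5, 5, 5, 5, 5, 3, 3, 3, 3, 1],
   [27, 9, 9, 9, 9, 7, 7, 7, 7, 5, 5, 5, 5, 5, 5, 5, 3, 3, 3, 3],
   [27, 9, 9, 9, 7, 7, 7, 7, 7, 7, 7, 5, 5, 5, 5, 3, 3, 3, 3, 3],
   [29, 9, 9, 9, 9, 9, 9, 7, 7, 7, 7, 5, 5, 5, 5, 5, 3, 3, 3, 3],
   [31, 11, 11, 9, 9, 9, 9, 7, 7, 7, 7, 7, 5, 5, 5, 5, 5, 3, 3, 3],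
   [33, 11, 11, 11, 9, 9, 9, 9, 9, 7, 7, 7, 7, 5, 5, 5, 5, 3, 3, 3]]

/-- Involutions generating the symmetry group of the chamber, acting on linear forms. -/
def chamberSymmetry : ℕ → List (List ℤ)
  | 0 =>
    [[15, -4, -4, -4, -4, -4, -4, -4, -4, -4, -4, -4, -4, -4, -4, 0, 0, 0, 0, 0],
     [4, -1, -1, -1, -1, -1, -1, -1, -1, -1, -1, -1, -1, -1, -2, 0, 0, 0, 0, 0],
     [4, -1, -1, -1, -1, -1, -1, -1, -1, -1, -1, -1, -1, -2, -1, 0, 0, 0, 0, 0],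
     [4, -1, -1, -1, -1, -1, -1, -1, -1, -1, -1, -1, -2, -1, -1, 0, 0, 0, 0, 0],
     [4, -1, -1, -1, -1, -1, -1, -1, -1, -1, -1, -2, -1, -1, -1, 0, 0, 0, 0, 0],
     [4, -1, -1, -1, -1, -1, -1, -1, -1, -1, -2, -1, -1, -1, -1, 0, 0, 0, 0, 0],
     [4, -1, -1, -1, -1, -1, -1, -1, -1, -2, -1, -1, -1, -1, -1, 0, 0, 0, 0, 0],
     [4, -1, -1, -1, -1, -1, -1, -1, -2, -1, -1, -1, -1, -1, -1, 0, 0, 0, 0, 0],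
     [4, -1, -1, -1, -1, -1, -1, -2, -1, -1, -1, -1, -1, -1, -1, 0, 0, 0, 0, 0],
     [4, -1, -1, -1, -1, -1, -2, -1, -1, -1, -1, -1, -1, -1, -1, 0, 0, 0, 0, 0],
     [4, -1, -1, -1, -1, -2, -1, -1, -1, -1, -1, -1, -1, -1, -1, 0, 0, 0, 0, 0],
     [4, -1, -1, -1, -2, -1, -1, -1, -1, -1, -1, -1, -1, -1, -1, 0, 0, 0, 0, 0],
     [4, -1, -1, -2, -1, -1, -1, -1, -1, -1, -1, -1, -1, -1, -1, 0, 0, 0, 0, 0],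
     [4, -1, -2, -1, -1, -1, -1, -1, -1, -1, -1, -1, -1, -1, -1, 0, 0, 0, 0, 0],
     [4, -2, -1, -1, -1, -1, -1, -1, -1, -1, -1, -1, -1, -1, -1, 0, 0, 0, 0, 0],
     [0, 0, 0, 0, 0, 0, 0, 0, 0, 0, 0, 0, 0, 0, 0, 1, 0, 0, 0, 0],
     [0, 0, 0, 0, 0, 0, 0, 0, 0, 0, 0, 0, 0, 0, 0, 0, 1, 0, 0, 0],
     [0, 0, 0, 0, 0, 0, 0, 0, 0, 0, 0, 0, 0, 0, 0, 0, 0, 1, 0, 0],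
     [0, 0, 0, 0, 0, 0, 0, 0, 0, 0, 0, 0, 0, 0, 0, 0, 0, 0, 1, 0],
     [0, 0, 0, 0, 0, 0, 0, 0, 0, 0, 0, 0, 0, 0, 0, 0, 0, 0, 0, 1]]
  | 1 =>
    [[31, -10, -10, -10, -10, -10, -10, -6, -6, -6, -6, -6, -6, -6, -6, -6, -6, 0, 0, 0],
     [10, -3, -3, -3, -3, -3, -4, -2, -2, -2, -2, -2, -2, -2, -2, -2, -2, 0, 0, 0],
     [10, -3, -3, -3, -3, -4, -3, -2, -2, -2, -2, -2, -2, -2, -2, -2, -2, 0, 0, 0],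
     [10, -3, -3, -3, -4, -3, -3, -2, -2, -2, -2, -2, -2, -2, -2, -2, -2, 0, 0, 0],
     [10, -3, -3, -4, -3, -3, -3, -2, -2, -2, -2, -2, -2, -2, -2, -2, -2, 0, 0, 0],
     [10, -3, -4, -3, -3, -3, -3, -2, -2, -2, -2, -2, -2, -2, -2, -2, -2, 0, 0, 0],
     [10, -4, -3, -3, -3, -3, -3, -2, -2, -2, -2, -2, -2, -2, -2, -2, -2, 0, 0, 0],
     [6, -2, -2, -2, -2, -2, -2, -1, -1, -1, -1, -1, -1, -1, -1, -1, -2, 0, 0, 0],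
     [6, -2, -2, -2, -2, -2, -2, -1, -1, -1, -1, -1, -1, -1, -1, -2, -1, 0, 0, 0],
     [6, -2, -2, -2, -2, -2, -2, -1, -1, -1, -1, -1, -1, -1, -2, -1, -1, 0, 0, 0],
     [6, -2, -2, -2, -2, -2, -2, -1, -1, -1, -1, -1, -1, -2, -1, -1, -1, 0, 0, 0],
     [6, -2, -2, -2, -2, -2, -2, -1, -1, -1, -1, -1, -2, -1, -1, -1, -1, 0, 0, 0],
     [6, -2, -2, -2, -2, -2, -2, -1, -1, -1, -1, -2, -1, -1, -1, -1, -1, 0, 0, 0],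
     [6, -2, -2, -2, -2, -2, -2, -1, -1, -1, -2, -1, -1, -1, -1, -1, -1, 0, 0, 0],
     [6, -2, -2, -2, -2, -2, -2, -1, -1, -2, -1, -1, -1, -1, -1, -1, -1, 0, 0, 0],
     [6, -2, -2, -2, -2, -2, -2, -1, -2, -1, -1, -1, -1, -1, -1, -1, -1, 0, 0, 0],
     [6, -2, -2, -2, -2, -2, -2, -2, -1, -1, -1, -1, -1, -1, -1, -1, -1, 0, 0, 0],
     [0, 0, 0, 0, 0, 0, 0, 0, 0, 0, 0, 0, 0, 0, 0, 0, 0, 1, 0, 0],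
     [0, 0, 0, 0, 0, 0, 0, 0, 0, 0, 0, 0, 0, 0, 0, 0, 0, 0, 1, 0],
     [0, 0, 0, 0, 0, 0, 0, 0, 0, 0, 0, 0, 0, 0, 0, 0, 0, 0, 0, 1]]
  | _ =>
    [[33, -11, -11, -11, -11, -10, -6, -6, -6, -6, -6, -6, -6, -6, -6, -6, -6, -6, -6, -6],
     [11, -3, -4, -4, -4, -3, -2, -2, -2, -2, -2, -2, -2, -2, -2, -2, -2, -2, -2, -2],
     [11, -4, -3, -4, -4, -3, -2, -2, -2, -2, -2, -2, -2, -2, -2, -2, -2, -2, -2, -2],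
     [11, -4, -4, -3, -4, -3, -2, -2, -2, -2, -2, -2, -2, -2, -2, -2, -2, -2, -2, -2],
     [11, -4, -4, -4, -3, -3, -2, -2, -2, -2, -2, -2, -2, -2, -2, -2, -2, -2, -2, -2],
     [10, -3, -3, -3, -3, -3, -2, -2, -2, -2, -2, -2, -2, -2, -2, -2, -2, -2, -2, -2],
     [6, -2, -2, -2, -2, -2, -1, -1, -1, -1, -1, -1, -1, -1, -1, -1, -1, -1, -1, -2],
     [6, -2, -2, -2, -2, -2, -1, -1, -1, -1, -1, -1, -1, -1, -1, -1, -1, -1, -2, -1],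
     [6, -2, -2, -2, -2, -2, -1, -1, -1, -1, -1, -1, -1, -1, -1, -1, -1, -2, -1, -1],
     [6, -2, -2, -2, -2, -2, -1, -1, -1, -1, -1, -1, -1, -1, -1, -1, -2, -1, -1, -1],
     [6, -2, -2, -2, -2, -2, -1, -1, -1, -1, -1, -1, -1, -1, -1, -2, -1, -1, -1, -1],
     [6, -2, -2, -2, -2, -2, -1, -1, -1, -1, -1, -1, -1, -1, -2, -1, -1, -1, -1, -1],
     [6, -2, -2, -2, -2, -2, -1, -1, -1, -1, -1, -1, -1, -2, -1, -1, -1, -1, -1, -1],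
     [6, -2, -2, -2, -2, -2, -1, -1, -1, -1, -1, -1, -2, -1, -1, -1, -1, -1, -1, -1],
     [6, -2, -2, -2, -2, -2, -1, -1, -1, -1, -1, -2, -1, -1, -1, -1, -1, -1, -1, -1],
     [6, -2, -2, -2, -2, -2, -1, -1, -1, -1, -2, -1, -1, -1, -1, -1, -1, -1, -1, -1],
     [6, -2, -2, -2, -2, -2, -1, -1, -1, -2, -1, -1, -1, -1, -1, -1, -1, -1, -1, -1],
     [6, -2, -2, -2, -2, -2, -1, -1, -2, -1, -1, -1, -1, -1, -1, -1, -1, -1, -1, -1],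
     [6, -2, -2, -2, -2, -2, -1, -2, -1, -1, -1, -1, -1, -1, -1, -1, -1, -1, -1, -1],
     [6, -2, -2, -2, -2, -2, -2, -1, -1, -1, -1, -1, -1, -1, -1, -1, -1, -1, -1, -1]]

/-- The permutations of the simple roots induced by the generating chamber symmetries. -/
def rootPermutation : ℕ → List ℕ
  | 0 =>
    [12, 11, 10, 9, 8, 7, 6, 5, 4, 3, 2, 1, 0, 21, 14, 15, 16, 17, 18, 20, 19, 13, 22, 29, 24, 28,
     31, 32, 25, 23, 30, 26, 27, 35, 34, 33, 38, 44, 36, 46, 42, 43, 40, 41, 37, 47, 39, 45, 49,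
     48]
  | 1 =>
    [4, 3, 2, 1, 0, 21, 14, 13, 12, 11, 10, 9, 8, 7, 6, 24, 16, 17, 18, 19, 20, 5, 22, 33, 15, 28,
     26, 32, 25, 35, 34, 31, 27, 23, 30, 29, 38, 40, 36, 48, 37, 47, 44, 45, 42, 43, 49, 41, 39,
     46]
  | _ =>
    [0, 1, 2, 19, 22, 17, 16, 15, 14, 13, 12, 11, 10, 9, 8, 7, 6, 5, 26, 3, 28, 25, 4, 23, 24, 21,
     18, 33, 20, 39, 30, 34, 37, 27, 31, 45, 43, 32, 41, 29, 40, 38, 48, 36, 47, 35, 46, 44, 42,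
     49]

/-- The charts at the cusps of the chamber, one for each orbit under the chamber symmetries. -/
def cuspCharts : List CuspChart := [
    { weight := 80,
      coweight := 2019402,
      decomposition := [(1, 1), (2, 2), (3, 2), (4, 2), (5, 2), (6, 2), (7, 2), (8, 2), (9, 2),
       (10, 2), (11, 2), (12, 2), (13, 2), (14, 2), (15, 2), (16, 2), (17, 2), (18, 2), (19, 1)],
      neighbours := [(1, []), (4, []), (2, []), (5, []), (3, []), (1, [0]), (0, [0]), (11, []),
       (7, []), (1, [2, 1, 2, 1, 0, 2, 1, 2, 0]), (10, [0]), (0, [2, 1, 2, 1, 0, 2, 1, 2, 1]), (1,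
       [2]), (9, [])],
      scale := 1649084035353550088832000,
      certificate := [(1, [(0, 1803247698715213411584000), (2, 1423221066106949805696000), (3,
       2036436514551675105408000), (4, 2851580824860149319168000), (5, 3279222031270397446080000),
       (6, 488188695352322321280000), (7, 2025669011006367397440000), (8,
       2129250072087529022016000), (9, 1679348638005478578673920), (10,
       1368066303702704365056000), (11, 1819136995107333967296000), (12,
       3307312402176098936632320), (13, 1972694253379829505292800), (14,
       971464660486602665644800), (15, 1128356683294544583818400), (16, 775023061760508465838080),
       (17, 629868681734795861529600), (18, 724102055183570152320000), (19,
       1572002203672718427456000), (52, 9343252324949292288000)]), (3, [(0,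
       3023576012792226786048000), (2, 1153291476971428591104000), (4, 1179854245421472475008000),
       (5, 2131505290999113587712000), (7, 1331305630258582573056000), (8,
       1664132037823228216320000), (9, 1451101428081387126696960), (10, 905968160711877415680000),
       (11, 1370913675305531437696000), (12, 2592311073581631910717440), (13,
       2303777837447261921433600), (14, 942504037117006537958400), (15,
       1652401257379602754147200), (16, 1599260837624251978498560), (17,
       1459228648758112016928000), (18, 575790772675853040768000), (19,
       1580436020874831740928000), (50, 2177406079098502190400), (59, 3358724120798138769600)]),
       (6, [(0, 345402020176222496256000), (4, 34473409786161561600000), (6,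
       158141380923737076096000), (7, 1965366797201024241024000), (8, 3772592213478311405952000),
       (9, 3849161300299884378458880), (10, 3404131405279262925696000), (11,
       3123632269242812263552000), (12, 2218418055503372378557440), (13,
       2207356860098119222944000), (14, 1127354833297334475187200), (15,
       759011095562813902670400), (16, 579217295261594448506880), (17, 679012441314918596582400),
       (19, 304722050010982081632000), (50, 28253921878412897990400), (53,
       1524640412495785939200), (58, 4263727880290392360000)]), (2, [(0,
       3154769458937226256896000), (4, 2442915092734106360832000), (5, 3322067839335412497792000),
       (7, 1872148542551131743360000), (8, 2246578251061358092032000), (9,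
       1948902777994336481560320), (10, 1382290088704488184320000), (11,
       2107605522370801267584000), (12, 4049761826848039359805440), (13,
       2640583008162392626713600), (14, 1068319657685560709721600), (15,
       1812299538611066308372800), (16, 1311137516832853869573120), (17,
       1675715206110812388403200), (18, 1194988431415616006400000), (19,
       1236813026515162566624000), (60, 5377447941370272028800)]), (7, [(0,
       1055573114417127472320000), (4, 800569531699695039744000), (8, 940057566046951258368000),
       (9, 1618790436150265612523520), (10, 1712758883006543606784000), (11,
       1689408747853994744192000), (12, 580954547869978100797440), (13, 809490853862040261859200),
       (14, 178451605758065323622400), (15, 196575596967868833052800), (16,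
       390628577690679479800320), (17, 363219578939327474707200), (19, 1007773577160502832064000),
       (50, 13642784591994949406400), (53, 5128492018158685360800), (57,
       4431415433166242690400)]), (8, [(0, 584799790314888219456000), (4,
       1067426042266260052992000), (9, 1281233836356357882620160), (10,
       1914537808060837470720000), (11, 2148673856763492554496000), (12,
       837316853506201299517440), (13, 1119987617661418634726400), (14, 380847652609168784793600),
       (15, 228375877118211654955200), (16, 239212143219967681397760), (17,
       236561973325453632384000), (19, 1147765913495033174496000), (50, 18729861512647408200000),
       (53, 6368152914300118788000), (56, 2322502827568278616800)]), (10, [(4,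
       1063423203606949211136000), (9, 747939690653868410480640), (11, 1408039750244295538304000),
       (12, 1802288689399363356702720), (13, 1563701677913735530156800), (14,
       1000009528029836400384000), (15, 897995468202258535560000), (16, 934047554126805864944640),
       (17, 380837701357946568806400), (19, 245233037541478292064000), (22,
       362913839364865206528000), (50, 16803620618513777136000), (52, 17103091084982339500800),
       (53, 343836461500941974400)]), (11, [(4, 1122602450319544971392000), (5,
       217163329758492192768000), (9, 1013790811089227719905280), (12, 1142188629808936228879360),
       (13, 977436958736278941296000), (14, 650132718464486002099200), (15,
       722011518496528600278400), (16, 919335516360402411630080), (17, 239509824182301322425600),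
       (19, 433195600507825572032000), (22, 479569019883336925696000), (50,
       13233390407158117996800), (52, 19001791353868066867200)]), (13, [(4,
       1841564779903074857241600), (5, 774153338818749902812800), (9, 243828853798703477420160),
       (13, 53006272564935538569600), (14, 306258463708516445068800), (15,
       454152508148953873670400), (16, 614872761753252247407360), (18, 98159764009139886240000),
       (19, 424050180519484308556800), (51, 9349717521870574164360), (52, 1619636106150808122960),
       (55, 10085915751939123311160)]), (15, [(4, 251910873475815715761600), (12,
       336687990551349809803200), (14, 13284288062570264604480), (16, 486021711530587956736320),
       (17, 791903896143736032241200), (18, 1408756213137839267354400), (19,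
       979143645991170365244000), (23, 181022964793522140207600), (51, 10821091484465910584145),
       (52, 6584884168946467368600), (54, 14372225447004898343640)]), (16, [(0,
       224690614019761965143040), (5, 201170885353595099389440), (9, 150687093672419175244800),
       (12, 395780168484852021319680), (17, 682395239787842577208320), (18,
       1474729415265921827005440), (19, 741266770934829683577600), (23, 187670029181777550558720),
       (51, 17955906054973779035520), (61, 2440125390808655190144)]), (4, [(0,
       3159908151583475964672000), (5, 999782748501476163840000), (9, 1263058672452859910073600),
       (12, 1477844593586108624701440), (14, 222888369619455485299200), (17,
       320753455229541564172800), (19, 1992225084630125504544000), (20, 469414725411659626368000),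
       (62, 2229998695542326016000)]), (17, [(5, 828468408237140639865600), (12,
       70675030086580718092800), (14, 315681801053393874147840), (18, 549694678451183362944000),
       (19, 1307488056601743284716800), (22, 1154358824747485062182400), (50,
       1766875752164517952320), (51, 17815997167658889352560)]), (9, [(0,
       287791762298796967115520), (5, 229216770218676245322240), (19, 868694912816886224213760),
       (21, 280344286010103515101440), (50, 17887242157665523140960), (63,
       7214742654671781638640)]), (12, [(0, 829861643597270367283200), (5,
       270000568942473720637440), (19, 1261283305749441051813120), (22, 659633614141420035532800),
       (50, 585158851254485515392), (52, 23087176494949701243648)]), (14, [(18,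
       648639720572396368273920), (21, 1583120673939408085278720), (23, 65963361414142003553280),
       (56, 2061355044191937611040), (58, 6184065132575812833120)]), (19, [(0,
       2061355044191937611040000), (5, 2198778713804733451776000), (18, 274847339225591681472000),
       (22, 412271008838387522208000)]), (5, [(0, 2931704951739644602368000), (58,
       11451972467732986728000)]), (18, [(51, 20613550441919376110400), (53,
       13742366961279584073600)])] },
    { weight := 62,
      coweight := 2605680,
      decomposition := [(0, 2), (1, 4), (2, 6), (3, 5), (4, 4), (5, 3), (6, 2), (7, 1), (19, 3)],
      neighbours := [(0, []), (11, []), (2, []), (10, [1, 0, 2, 1, 2]), (6, []), (8, []), (1,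
       [0]), (2, [1]), (2, [1, 0, 2, 1, 2]), (3, []), (1, [2, 1, 2, 1, 0]), (1, [1, 0, 2, 1, 2]),
       (10, []), (10, [2, 1, 2]), (5, []), (7, []), (9, []), (10, [0, 2, 1, 0, 2, 1, 2]), (10, [1,
       0]), (1, [2, 1, 2, 1, 0, 2, 1, 2, 0]), (5, [0])],
      scale := 704692207271802954854990788779517056,
      certificate := [(0, [(1, 187643728605158110568759374035319104), (2,
       584380142738927437542625167023681424), (3, 737224248263169646818091500292911840), (4,
       412294100964666766665475680745583616), (5, 305072241968119296290443435363972896), (6,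
       188028758656846078988675117096985984), (7, 188028758656846078988675117096985984), (9,
       40509965981695051009591696126777248), (11, 260374380791091820929403343838660672), (12,
       240806761777689089388497622966452706), (14, 166935845426646258035723670977964800), (15,
       32556318161780863096650654386007168), (16, 696644216835801315440310151727978880), (17,
       28524349777136287204805170549921920), (18, 94430828614226785745725333294517376), (19,
       125352505771230719325783411397990656), (20, 91457840518446886132201229906749728), (52,
       385697388369344398130095720447104), (55, 2977498448713769352313364273594016), (62,
       3243223274550216635751279924197376)]), (3, [(1, 824222523294931499774968993257185664), (2,
       488024949211220754614811524958798016), (4, 479819095548258907763785473778160640), (5,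
       803716214759059483428390615926593296), (6, 766661259721314660260954730388689024), (7,
       618366578181714928866321261565576992), (9, 6253267186049491760394093357570480), (10,
       6009310689582514783211103567671712), (12, 190392305476220566101505578105577980), (13,
       340941547819101962092995271481695968), (15, 42125467778414793594911649159529760), (16,
       100136816255911694504586787768791040), (18, 1716820863733873872582483279684800), (19,
       322357790712629576886020394603143168), (21, 94258055361891368342366627273972224), (52,
       6663178532686438623157341766168096), (53, 6513684431936095991639006112139920), (64,
       3852026615472126813089218542333616), (69, 444579710875540481028483163222976)]), (5, [(1,
       524433974630464254051031556396599488), (2, 633173587919088770388317630446439712), (4,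
       328101345950969474097874195082466816), (6, 94014379328423039494337558548492992), (7,
       188028758656846078988675117096985984), (9, 251821215656357803794179114997458592), (10,
       484150760265166201375626980552509440), (11, 188795766663940105597509945290416320), (12,
       233676797551756185622738878419333400), (13, 619305306019465929524304898588285536), (14,
       303281563517206264780017696453643840), (15, 197416226247517392655776983602598304), (16,
       39930192640365495862628427111786816), (17, 223100518437482847990561411305852160), (19,
       363593983623755904941327594497466352), (20, 103629390749466158689136985588966000), (56,
       2831697176885642354075039958072264), (65, 6074046150336023883179299898339520)]), (12, [(2,
       228957896604086966665948538961875646), (4, 120713837321183691693494593265166810), (6,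
       231154377850184014363371786254130012), (8, 321974014337030518976933588129991588), (9,
       404503661415853538596349182018018098), (10, 431733615919515609739205335897980096), (11,
       606956577571525562930864094762688992), (13, 15745222254062051267934189219495516), (14,
       37515452420103442852070813842381752), (15, 135118382178540470276701703759704596), (16,
       78134904427904312914988828267840910), (17, 96721705916565914783070950233029768), (18,
       48808027372311362649018026783119176), (20, 364253860290673289352770767304250606), (52,
       7630325436419082237378289219532766), (59, 678922776658587388021648700719599), (65,
       1091393377897623753305314972957635)]), (14, [(1, 93685060929048450209573280288759552), (2,
       85000596050242418768810070709240768), (4, 229083575525115901179525125800523264), (6,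
       640331928957025181105387975228076288), (8, 6025007911979340316202435403390720), (10,
       12050015823958680632404870806781440), (11, 212098522822890689546889962821799040), (13,
       24499112470469201510334846144200448), (15, 27680649418017122673885769744711488), (16,
       25396435674042297316135927505847936), (17, 25185777401790537239941158848554944), (19,
       17633031077616196947516351417062432), (20, 31310923345132612654495689076096128), (21,
       318772889245051316479055171694304000), (54, 5456774322382289075746556992626016), (67,
       745167663502597231268201206393536)]), (9, [(1, 12768525434065075017006136618456272), (4,
       80299715185635937062845449030950816), (6, 489711205419499411251753853251458496), (7,
       484289663774629036503930019182278352), (8, 662203773541575940344973836057813600), (10,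
       656537025637816771251382446617421984), (11, 491141041205738150869303832951751360), (13,
       9306167209805731881988033449473088), (15, 75148643706669616387786985791775808), (16,
       11522357540970030713707264620269568), (18, 191584058742654398021435217620832), (19,
       37621222119012192769907180704951200), (20, 202751717271347557807210613170115712), (52,
       407357107252739692191316396057536), (60, 231157343439006269281266876771672)]), (2, [(1,
       598743921486390283823432491568770272), (4, 636559443272487454342276244394181248), (6,
       376057517313692157977350234193971968), (7, 470071896642115197471687792742464960), (11,
       52236742299951716620273250323753104), (13, 267165489000283916219916671519007408), (15,
       203928229182459057751894298261662800), (16, 650523987634505964892591599377679456), (17,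
       298117503203573698836169125327734736), (19, 310584784487556151949197902742026144), (20,
       151142800140659144005898536623676464), (52, 6428957183547030874227535706708064), (61,
       3493071050953759878304199099895696), (64, 6320378411071165278348963260456232)]), (15, [(4,
       328702979781393075609806868488256384), (6, 223838478855142588457558783921738304), (8,
       58588476944236210981932757400812032), (10, 146471192360590527454831893502030080), (11,
       226223585514971061542114265969844032), (13, 66535237561489188407580116433192192), (17,
       21749145599304248364761411823304320), (18, 5452657805932071632505996905578752), (19,
       5463855338883016637013357999581280), (20, 64410843560188702683839714524440000), (51,
       207687753135048587913167935727808), (57, 4484338001652832175016353509179264), (68,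
       1077837608756901541428589900399200)]), (4, [(1, 710307522854967748624477609049372160), (6,
       188028758656846078988675117096985984), (7, 282043137985269118483012675645478976), (10,
       147604983006238936650536731766963136), (13, 783021787105396838375599650580997376), (16,
       132426020116004196512002516511857920), (17, 367668221153345246270529479470730112), (19,
       380955974521859086834029827896085952), (56, 3658363438602950118663583756028832), (58,
       2574096007131876134301781834010304), (64, 3617182940448720768980654252396736)]), (6, [(1,
       318917177776509265624113357973074432), (7, 215316131106762304518536571965464512), (8,
       242603503556678530048398026833943040), (10, 710830012552254417504801347079096960), (11,
       298748775590714690655221024953354944), (13, 438793601665716556245445314231058176), (18,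
       276272709980132177709425856432079488), (19, 219366885099653758820120969946483648), (53,
       1686856518439773535724929893737280), (54, 6206306000351204695508202635521632)]), (16, [(1,
       469382714700309607510599513460002432), (7, 29310038137499567845219412671553472), (8,
       28623613782244262950297145417236992), (10, 21802292245439551307712723482947392), (11,
       86591286753686257459654056162819456), (13, 37342333393392817924506807748110720), (17,
       25558073827907036515143631645398912), (19, 203329137397225998743945376160296672), (53,
       1117751495253895846902301809590304), (55, 11533777209731650328487694555238592)]), (11, [(1,
       31377939393295304273437045154192448), (7, 209719765532232772471508446312271136), (8,
       627204875320070393587458723931636224), (10, 313602437660035196793729361965818112), (13,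
       297075390283344718566923868265205952), (17, 36177431546906045411794568352388800), (20,
       284419138422950370880766392353455808), (52, 7824260466777270928316112667132128)]), (17,
       [(13, 24623469129896973577491380694802368), (18, 13560365374683778044511715351115648), (19,
       109978500593645950479747678834797952), (51, 601521303633153923183903011982592), (53,
       1336467065813311621813781089447008), (58, 5158215232407630320702116607018208), (65,
       418630310494612589165693266334592)]), (1, [(7, 347487347545100711800731796083523200), (19,
       238742581819167394403912873119825920), (20, 330756752127964686998021325195032160), (21,
       187258698553470142148843630973652224), (61, 1189485154556133778745183300890176), (64,
       6555263859563296820369828512280832)]), (10, [(7, 768177185017441470255133091086566240), (8,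
       1285424204988053068264485173230811712), (18, 5504645677572263261622632524862400), (20,
       223708692423969026588519399433938400), (59, 1033363695182148992631914722076832), (64,
       482997261727900031470303964189184)]), (13, [(19, 87947679583156388797857809422839456), (20,
       59396583486413105720162739571985856), (51, 733033468056296778853732117511904), (56,
       5509722570623575995989977099492032), (63, 564942845350098149658385449235968)]), (18, [(7,
       48549482093177566009838114767263360), (25, 136079630922878537111610982650127872), (53,
       9690116227394565153582873066532896), (64, 198413069180001181348472653368384), (66,
       400392784952303991702888446614656)]), (19, [(7, 250705011542461438651566822795981312), (22,
       272754935896399722023326541908991712), (66, 1730269657881790392119414803133616), (70,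
       1860049784341203137305830407481840)]), (20, [(8, 229949923752712272629510169068388096),
       (50, 4170730454868604647246943586772240), (64, 208008413079865909117730538305904)]), (7,
       [(8, 167916024119234259064841531540644224), (51, 3570659708259239163675900795890160)])] },
    { weight := 47,
      coweight := 3437280,
      decomposition := [(13, 1), (14, 2), (15, 2), (16, 2), (17, 2), (18, 2), (21, 1)],
      neighbours := [(0, []), (0, [0]), (1, []), (1, [0]), (4, []), (4, [0]), (10, []), (10, [0]),
       (6, []), (3, []), (8, []), (8, [0]), (1, [2, 1, 2, 1, 0]), (1, [0, 2, 1, 2, 1, 0]), (7, [2,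
       1, 2, 0]), (2, [2, 1, 2]), (2, [0, 2, 1, 2]), (12, []), (1, [0, 2, 1, 2, 1, 0, 2, 1]), (1,
       [2, 1, 2, 1, 0, 2, 1]), (10, [2, 1, 2]), (10, [0, 2, 1, 2])],
      scale := 97580828538975600,
      certificate := [(14, [(0, 55252907370220560), (1, 76646531743978560), (2,
       26651131342123344), (3, 10608036601965600), (4, 2646590437352160), (5, 14666185625244660),
       (7, 14666185625244660), (8, 2646590437352160), (9, 10608036601965600), (10,
       26651131342123344), (11, 76646531743978560), (12, 55252907370220560), (13,
       53584848041634000), (15, 67736436436672920), (16, 60525787212399600), (17,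
       38087227478583816), (18, 38355470177169600), (19, 11627523572070900), (20,
       11627523572070900), (21, 53584848041634000), (52, 348287804515560), (53,
       348287804515560)]), (16, [(1, 2040184583892000), (2, 9236152694116044), (3,
       11817936698777640), (4, 1323295218676080), (5, 7333092812622330), (7, 7333092812622330),
       (8, 1323295218676080), (9, 11817936698777640), (10, 9236152694116044), (11,
       2040184583892000), (13, 39851761150492200), (15, 50936919668107200), (17,
       12695742492861272), (18, 19177735088584800), (19, 51480813278676600), (20,
       51480813278676600), (21, 39851761150492200), (59, 879745789868400), (60, 496211796498600),
       (61, 496211796498600)]), (2, [(0, 54174813226166592), (1, 46265141701668096), (3,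
       58604730484670194), (4, 16193868659030268), (5, 5324170156294014), (7, 3212922126554856),
       (8, 573135661567692), (9, 2642746766974278), (10, 5430851846313408), (11,
       1357712961578352), (17, 5356332872688768), (18, 47375161254164052), (19, 5152457241033246),
       (20, 3855101416187778), (21, 38361319688808468), (53, 224380728334584), (57,
       1373225921898732), (59, 106271849132316)]), (3, [(0, 51154603704392840), (1,
       67535760839948880), (4, 3770813529593780), (5, 1433902185312100), (7, 3140242970372430),
       (8, 427777349202840), (10, 2642746766974278), (11, 3637063947640500), (12,
       4849418596854000), (17, 15754591921107540), (19, 31557760850949590), (20, 499232987306040),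
       (21, 24340933016708890), (53, 49563945974940), (57, 629213052987900), (58, 84318023982220),
       (63, 460661902704540)]), (9, [(0, 4849418596854000), (1, 3637063947640500), (4,
       427777349202840), (5, 3140242970372430), (7, 1433902185312100), (8, 3770813529593780), (10,
       58604730484670194), (11, 67535760839948880), (12, 51154603704392840), (13,
       24340933016708890), (17, 15754591921107540), (19, 499232987306040), (20,
       31557760850949590), (52, 49563945974940), (56, 629213052987900), (58, 84318023982220), (62,
       460661902704540)]), (5, [(1, 7547843253092220), (4, 1869755014251540), (6,
       11626725514866930), (7, 15979323134452860), (8, 5778840943400850), (10, 3212922126554856),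
       (11, 3994830783613215), (13, 7392057729963660), (15, 10007167804926435), (17,
       25809714260746845), (19, 3982234943554920), (20, 1855465797890835), (28, 5506818961892040),
       (67, 374011257691890), (71, 894514340530395)]), (7, [(1, 3994830783613215), (4,
       5778840943400850), (6, 11626725514866930), (8, 1869755014251540), (10, 5324170156294014),
       (11, 7547843253092220), (15, 10007167804926435), (17, 25809714260746845), (19,
       1855465797890835), (20, 3982234943554920), (21, 7392057729963660), (25, 5506818961892040),
       (67, 374011257691890), (70, 894514340530395)]), (10, [(1, 1357712961578352), (4,
       573135661567692), (8, 16193868659030268), (11, 46265141701668096), (12, 54174813226166592),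
       (13, 38361319688808468), (17, 5356332872688768), (18, 47375161254164052), (19,
       3855101416187778), (20, 5152457241033246), (52, 224380728334584), (56, 1373225921898732),
       (59, 106271849132316)]), (15, [(1, 15309616085015580), (11, 15309616085015580), (13,
       71538398794812060), (17, 25391484985722544), (18, 28766602632877200), (19,
       25918836209206830), (20, 25918836209206830), (21, 71538398794812060), (52,
       597474745365600), (53, 597474745365600), (58, 42232826127960), (59, 634987066006440)]), (4,
       [(0, 9285038374945320), (1, 18873905919237720), (8, 5704973295259680), (11,
       1426243323814920), (13, 33521241424830120), (19, 9952656760320300), (28,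
       68132420875312560), (52, 107729941945860), (53, 605169200507040), (58, 18904177131840)]),
       (17, [(6, 22143167854435680), (13, 30185918757868744), (18, 9588867544292400), (21,
       30185918757868744), (22, 3700988768560408), (50, 33051861154988), (51, 33051861154988),
       (64, 756903539361840), (65, 242604419827380), (66, 242604419827380)]), (8, [(1,
       1426243323814920), (11, 18873905919237720), (12, 9285038374945320), (20, 9952656760320300),
       (21, 33521241424830120), (25, 68132420875312560), (52, 605169200507040), (53,
       107729941945860), (58, 18904177131840)]), (6, [(1, 3637063947640500), (11,
       3637063947640500), (19, 784577300010660), (20, 784577300010660), (52, 77384339311500), (53,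
       77384339311500), (58, 661734036241200), (67, 1463703584779800)]), (13, [(1,
       12574309078040580), (11, 80987720840650260), (12, 36603922767377940), (18,
       28766602632877200), (20, 4787935488367200), (21, 9588867544292400), (53,
       546681257737290)]), (19, [(1, 10916401937504310), (11, 713121661907460), (12,
       1426243323814920), (21, 4787935488367200), (53, 115081840498950), (55, 1009848508005870)]),
       (20, [(0, 1426243323814920), (1, 713121661907460), (11, 10916401937504310), (52,
       115081840498950), (54, 1009848508005870)]), (21, [(0, 36603922767377940), (1,
       80987720840650260), (11, 12574309078040580), (18, 28766602632877200), (52,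
       546681257737290)]), (1, [(0, 78403093450390800), (57, 306027687583800)]), (11, [(12,
       78403093450390800), (56, 306027687583800)]), (18, [(68, 312028230477600), (69,
       312028230477600)])] },
    { weight := 32,
      coweight := 5048505,
      decomposition := [(16, 1), (17, 2), (18, 2), (22, 1)],
      neighbours := [(4, []), (4, [0]), (4, [1]), (4, [1, 0]), (1, []), (1, [0]), (1, [1, 0]), (1,
       [1]), (1, [2, 1, 2, 1, 0, 2, 1, 2]), (1, [2, 0, 2, 1, 2, 1, 2, 0, 2]), (1, [2, 1, 2, 1, 0,
       2, 1, 2, 0]), (1, [2, 1, 2, 1, 0, 2, 1, 2, 1]), (5, []), (6, []), (5, [0]), (6, [2, 1, 2,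
       1, 0, 2, 1, 2]), (5, [1]), (5, [1, 0]), (8, []), (8, [0])],
      scale := 47360,
      certificate := [(0, [(0, 448), (1, 6240), (3, 4416), (5, 5664), (6, 10432), (7, 15360), (8,
       42624), (9, 15360), (10, 10432), (11, 5664), (13, 4416), (16, 15224), (17, 20208), (18,
       3568), (21, 6240), (22, 15224), (50, 577), (68, 503)]), (4, [(1, 4416), (3, 6240), (4,
       448), (5, 6240), (7, 4416), (9, 5664), (10, 10432), (11, 15360), (12, 42624), (13, 15360),
       (14, 10432), (16, 15224), (17, 20208), (18, 3568), (21, 5664), (22, 15224), (52, 577), (69,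
       503)]), (2, [(1, 17536), (3, 17536), (5, 11328), (7, 1728), (8, 10432), (12, 10432), (13,
       1728), (15, 224), (16, 14400), (17, 16640), (19, 47584), (20, 224), (21, 11328), (22,
       25280), (24, 224), (68, 163), (69, 163)]), (6, [(1, 1728), (3, 11328), (5, 17536), (7,
       17536), (9, 11328), (11, 1728), (12, 10432), (15, 224), (16, 25280), (17, 16640), (19,
       224), (20, 224), (22, 14400), (24, 47584), (68, 163), (69, 163)]), (8, [(1, 15360), (3,
       5664), (5, 4416), (7, 6240), (8, 448), (9, 6240), (11, 4416), (13, 5664), (14, 10432), (16,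
       15224), (17, 20208), (18, 3568), (21, 15360), (22, 15224), (53, 577), (68, 503)]), (10,
       [(5, 1728), (7, 11328), (9, 17536), (11, 17536), (13, 11328), (15, 224), (16, 14400), (17,
       16640), (19, 224), (20, 47584), (21, 1728), (22, 25280), (24, 224), (68, 163), (69, 163)]),
       (12, [(1, 5664), (3, 15360), (5, 15360), (7, 5664), (9, 4416), (11, 6240), (12, 448), (13,
       6240), (16, 15224), (17, 20208), (18, 3568), (21, 4416), (22, 15224), (51, 577), (69,
       503)]), (14, [(1, 11328), (3, 1728), (9, 1728), (11, 11328), (13, 17536), (15, 47584), (16,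
       25280), (17, 16640), (19, 224), (20, 224), (21, 17536), (22, 14400), (24, 224), (68, 163),
       (69, 163)]), (1, [(3, 21952), (5, 8960), (7, 1216), (11, 448), (13, 8960), (19, 24320),
       (21, 33984), (58, 112), (59, 8), (62, 520)]), (9, [(3, 448), (5, 8960), (7, 33984), (11,
       21952), (13, 8960), (20, 24320), (21, 1216), (58, 8), (59, 112), (67, 520)]), (3, [(5,
       33984), (7, 8960), (13, 1216), (19, 24320), (21, 8960), (60, 112), (61, 8), (66, 520)]),
       (11, [(5, 1216), (7, 8960), (13, 33984), (20, 24320), (21, 8960), (60, 8), (61, 112), (64,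
       520)]), (5, [(7, 21952), (21, 448), (24, 24320), (55, 8), (57, 112), (66, 520)]), (13, [(7,
       448), (15, 24320), (21, 21952), (55, 112), (57, 8), (64, 520)]), (17, [(16, 41600), (17,
       14080), (18, 61440), (22, 41600), (68, 400), (69, 400)]), (7, [(24, 24320), (54, 8), (56,
       112), (67, 520)]), (18, [(16, 58240), (22, 58240), (68, 400), (69, 400)]), (21, [(15,
       24320), (54, 112), (56, 8), (62, 520)]), (16, [(22, 21760), (65, 400)]), (22, [(63, 400)])] },
    { weight := 56,
      coweight := 2884860,
      decomposition := [(17, 1), (18, 2), (23, 1)],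
      neighbours := [(0, []), (0, [2, 1, 2, 1, 0, 2, 1, 2]), (11, [2, 1, 2]), (2, []), (2, [2, 1,
       2, 1, 0, 2, 1, 2]), (10, []), (10, [1, 2, 1, 0, 2, 1, 2]), (5, []), (3, []), (8, []), (1,
       [2, 1, 2, 1, 0]), (1, [2, 1, 2])],
      scale := 13466893440,
      certificate := [(6, [(0, 119528640), (1, 2251122720), (2, 2354222640), (3, 2448735520), (4,
       119528640), (5, 1101371040), (7, 1004609760), (8, 1849848000), (9, 1909612320), (10,
       3938753280), (11, 2029140960), (12, 2088905280), (13, 2148669600), (14, 2208433920), (15,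
       4799397120), (17, 745631040), (19, 1892372160), (21, 1163981280), (24, 12482205120), (52,
       52446240)]), (10, [(0, 119528640), (1, 1163981280), (2, 2208433920), (3, 2148669600), (4,
       2088905280), (5, 2029140960), (7, 1909612320), (8, 1849848000), (9, 1004609760), (11,
       1101371040), (12, 119528640), (13, 2448735520), (14, 2354222640), (15, 1892372160), (17,
       745631040), (19, 4799397120), (20, 12482205120), (21, 2251122720), (52, 52446240)]), (15,
       [(1, 4843214880), (2, 7689346560), (3, 6690804960), (4, 5692263360), (5, 4693721760), (7,
       2696638560), (8, 1698096960), (9, 1775313120), (11, 11335511040), (12, 5576883648), (13,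
       15276975840), (14, 14909886600), (16, 11544556800), (17, 3136697760), (18, 984170880), (19,
       7689346560), (21, 9211114080), (57, 35662200)]), (19, [(1, 9211114080), (2, 14909886600),
       (3, 15276975840), (4, 5576883648), (5, 11335511040), (7, 1775313120), (8, 1698096960), (9,
       2696638560), (11, 4693721760), (12, 5692263360), (13, 6690804960), (14, 7689346560), (17,
       3136697760), (18, 984170880), (21, 4843214880), (22, 11544556800), (57, 35662200)]), (18,
       [(3, 1438680320), (4, 573737472), (7, 7672600320), (8, 2458874880), (9, 7672600320), (12,
       573737472), (13, 1438680320), (17, 2071829760), (23, 2071829760), (55, 65456160), (56,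
       65456160), (57, 72570960)]), (2, [(1, 14097911520), (2, 6345496080), (3, 14215921720), (4,
       7959624288), (5, 18910685640), (7, 1137268440), (17, 3559469760), (22, 19629603840), (51,
       84101325), (59, 18111555)]), (14, [(9, 1137268440), (11, 18910685640), (12, 7959624288),
       (13, 14215921720), (14, 6345496080), (16, 19629603840), (17, 3559469760), (21,
       14097911520), (50, 84101325), (59, 18111555)]), (3, [(1, 9643578560), (4, 6403531904), (5,
       17485776000), (7, 1214407040), (17, 4408009760), (22, 17856016640), (54, 101314400), (59,
       16734080)]), (9, [(9, 79685760), (11, 600489120), (12, 79685760), (13, 1214407040), (17,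
       11266997280), (21, 1075757760), (59, 35574000), (60, 120951600)]), (23, [(0, 504504000),
       (4, 2952926592), (8, 4166426880), (12, 2952926592), (17, 2071829760), (53, 4047120), (54,
       4047120), (58, 84638400)]), (5, [(1, 10976713440), (4, 12425286720), (7, 600489120), (22,
       3312650880), (52, 27696900), (54, 192302880), (56, 27900180)]), (11, [(12, 12425286720),
       (13, 17485776000), (16, 3312650880), (21, 10976713440), (52, 27696900), (53, 192302880),
       (55, 27900180)]), (7, [(1, 1075757760), (4, 79685760), (7, 79685760), (17, 11266997280),
       (59, 35574000), (61, 120951600)]), (13, [(12, 6403531904), (16, 17856016640), (17,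
       4408009760), (21, 9643578560), (53, 101314400), (59, 16734080)]), (4, [(1, 6008306304),
       (22, 3729293568), (52, 36996960), (54, 207182976)]), (12, [(16, 3729293568), (21,
       6008306304), (52, 36996960), (53, 207182976)]), (1, [(22, 8287319040), (51, 64744680)]),
       (8, [(17, 4735610880), (59, 277477200)]), (21, [(16, 8287319040), (50, 64744680)]), (17,
       [(52, 101741640)])] },
    { weight := 36,
      coweight := 4487560,
      decomposition := [(0, 1), (23, 1)],
      neighbours := [(4, []), (4, [2]), (4, [1, 2, 1, 0, 2, 1]), (0, []), (0, [2, 1, 2, 1, 0, 2,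
       1, 2]), (0, [2]), (0, [1, 2, 1, 0, 2, 1, 2]), (0, [2, 1, 2, 1, 0, 2, 1]), (0, [1, 2, 1, 0,
       2, 1]), (10, []), (10, [1, 2, 1, 0, 2, 1, 2]), (10, [2]), (11, [2, 1, 2]), (11, [0, 2, 1,
       2, 1, 0, 2, 0]), (11, [1, 2]), (3, []), (3, [2]), (3, [1, 2, 1, 0, 2]), (2, []), (2, [2, 1,
       2, 1, 0, 2, 1, 2]), (2, [1, 2, 1, 0, 2, 1, 2]), (2, [2]), (2, [1, 2, 1, 0, 2, 1]), (2, [2,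
       1, 2, 1, 0, 2, 1]), (1, []), (1, [2, 1, 2, 1, 0, 2, 1, 2]), (1, [2]), (1, [2, 1, 2, 1, 0,
       2, 1]), (1, [1, 2, 1, 0, 2, 1]), (1, [1, 2, 1, 0, 2, 1, 2])],
      scale := 31428432,
      certificate := [(2, [(0, 627840), (1, 24575616), (3, 19085688), (4, 20836296), (5, 5562648),
       (6, 7321176), (7, 3813912), (8, 1890432), (9, 4450104), (10, 9949320), (11, 13332168), (12,
       9949320), (13, 4450104), (14, 1890432), (15, 3813912), (16, 7321176), (17, 5562648), (19,
       19085688), (22, 20836296), (68, 177228), (71, 177228)]), (8, [(0, 627840), (3, 3813912),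
       (4, 7321176), (5, 5562648), (6, 20836296), (7, 19085688), (9, 19085688), (10, 20836296),
       (11, 5562648), (12, 7321176), (13, 3813912), (14, 1890432), (15, 4450104), (16, 9949320),
       (17, 13332168), (19, 4450104), (22, 9949320), (25, 24575616), (70, 177228), (72, 177228)]),
       (14, [(0, 627840), (3, 4450104), (4, 9949320), (5, 13332168), (6, 9949320), (7, 4450104),
       (9, 3813912), (10, 7321176), (11, 5562648), (12, 20836296), (13, 19085688), (15, 19085688),
       (16, 20836296), (17, 5562648), (19, 3813912), (21, 24575616), (22, 7321176), (69, 177228),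
       (73, 177228)]), (4, [(0, 2244564), (1, 13440420), (3, 16698780), (5, 5487048), (7,
       8982036), (9, 9309132), (10, 15985368), (11, 15923124), (12, 29549520), (13, 11827872),
       (16, 15985368), (19, 8285760), (22, 2172240), (56, 8407), (61, 222019), (71, 301140)]), (6,
       [(0, 2244564), (3, 8982036), (5, 5487048), (7, 16698780), (9, 8285760), (10, 2172240), (12,
       15985368), (15, 11827872), (16, 29549520), (17, 15923124), (19, 9309132), (22, 15985368),
       (25, 13440420), (55, 8407), (60, 222019), (70, 301140)]), (10, [(0, 2244564), (7, 8285760),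
       (9, 16698780), (11, 5487048), (13, 8982036), (15, 9309132), (16, 15985368), (17, 15923124),
       (19, 11827872), (22, 29549520), (25, 13440420), (57, 8407), (59, 222019), (72, 301140)]),
       (12, [(0, 2244564), (3, 11827872), (5, 15923124), (7, 9309132), (9, 8982036), (11,
       5487048), (13, 16698780), (15, 8285760), (16, 2172240), (21, 13440420), (22, 15985368),
       (58, 8407), (61, 222019), (73, 301140)]), (16, [(0, 2244564), (3, 9309132), (5, 15923124),
       (7, 11827872), (13, 8285760), (15, 16698780), (17, 5487048), (19, 8982036), (21, 13440420),
       (53, 8407), (60, 222019), (69, 301140)]), (22, [(0, 2244564), (1, 13440420), (3, 8285760),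
       (9, 11827872), (11, 15923124), (13, 9309132), (15, 8982036), (17, 5487048), (19, 16698780),
       (54, 8407), (59, 222019), (68, 301140)]), (5, [(0, 11713824), (3, 11325888), (7, 11325888),
       (13, 4183200), (15, 4183200), (51, 288648), (59, 88464), (64, 284088), (70, 23256), (71,
       23256)]), (11, [(0, 11713824), (3, 4183200), (9, 11325888), (13, 11325888), (19, 4183200),
       (52, 288648), (60, 88464), (63, 284088), (72, 23256), (73, 23256)]), (17, [(0, 11713824),
       (7, 4183200), (9, 4183200), (15, 11325888), (19, 11325888), (50, 288648), (61, 88464), (62,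
       284088), (68, 23256), (69, 23256)]), (3, [(1, 23113440), (7, 14724864), (13, 3443328), (19,
       16410240), (61, 180096), (66, 168392), (76, 101752)]), (9, [(7, 16410240), (13, 14724864),
       (19, 3443328), (25, 23113440), (59, 180096), (67, 168392), (78, 101752)]), (15, [(7,
       3443328), (13, 16410240), (19, 14724864), (21, 23113440), (60, 180096), (65, 168392), (75,
       101752)]), (7, [(25, 23113440), (60, 180096), (66, 168392), (79, 101752)]), (13, [(21,
       23113440), (61, 180096), (67, 168392), (77, 101752)]), (19, [(1, 23113440), (59, 180096),
       (65, 168392), (74, 101752)]), (0, [(0, 2325960), (23, 18040176)])] },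
    { weight := 36,
      coweight := 4487560,
      decomposition := [(15, 1), (16, 2), (17, 2), (18, 2), (24, 1)],
      neighbours := [(1, []), (1, [0]), (1, [1, 0]), (1, [1]), (11, []), (11, [0]), (2, []), (2,
       [1]), (10, [1, 0, 2, 1, 2]), (10, [2, 1, 2]), (10, [1, 2, 1, 2]), (10, [0, 2, 1, 2]), (3,
       []), (8, []), (8, [0]), (7, []), (7, [0]), (2, [2, 1, 2, 1, 0, 2, 1, 2]), (2, [1, 2, 1, 0,
       2, 1, 2]), (2, [2, 1, 2, 1, 0, 2, 1, 2, 1]), (2, [2, 1, 0, 2, 1, 2]), (2, [2, 1, 2, 1, 2,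
       0, 2, 1]), (2, [0, 2, 1, 0, 2, 1, 2]), (10, []), (10, [1, 2, 1, 0, 2, 1, 2]), (10, [0]),
       (10, [2, 1, 0, 2, 1, 2]), (10, [1, 0, 2, 1, 0, 2, 1, 2]), (10, [0, 2, 1, 0, 2, 1, 2]), (10,
       [1, 0]), (10, [1])],
      scale := 6477645009312,
      certificate := [(17, [(0, 986200915320), (1, 90577729044), (3, 90577729044), (4,
       986200915320), (6, 411369196032), (8, 986200915320), (9, 90577729044), (11, 90577729044),
       (12, 986200915320), (14, 411369196032), (15, 7164708390144), (16, 5759875171296), (18,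
       2809666437696), (19, 1720664328096), (20, 1720664328096), (22, 717769838016), (24,
       7164708390144), (50, 17630830122), (51, 17630830122), (52, 17630830122), (53,
       17630830122)]), (2, [(0, 5865393893616), (1, 3865036114824), (3, 3865036114824), (4,
       5865393893616), (5, 6600675518424), (8, 257492384064), (9, 223804307880), (11,
       223804307880), (12, 257492384064), (16, 2226584174976), (18, 982767148704), (19,
       3464816220144), (21, 6600675518424), (51, 7588415860), (52, 7588415860), (59, 53450898640),
       (60, 53450898640), (62, 90601496352), (75, 11325187044), (79, 11325187044)]), (10, [(0,
       257492384064), (1, 223804307880), (3, 223804307880), (4, 257492384064), (7, 6600675518424),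
       (8, 5865393893616), (9, 3865036114824), (11, 3865036114824), (12, 5865393893616), (13,
       6600675518424), (16, 2226584174976), (18, 982767148704), (20, 3464816220144), (50,
       7588415860), (53, 7588415860), (58, 53450898640), (61, 53450898640), (62, 90601496352),
       (73, 11325187044), (80, 11325187044)]), (16, [(0, 3115014584256), (1, 2357137496736), (3,
       2357137496736), (4, 3115014584256), (6, 863751991392), (8, 3115014584256), (9,
       2357137496736), (11, 2357137496736), (12, 3115014584256), (14, 863751991392), (15,
       3241542433392), (18, 5619332875392), (19, 2495238437088), (20, 2495238437088), (24,
       3241542433392), (67, 19473795696), (69, 19473795696)]), (0, [(1, 5545305841296), (3,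
       5532656907648), (4, 3667978571616), (5, 3667978571616), (8, 234611662752), (11,
       763753915512), (14, 2469219811056), (15, 1768730705496), (19, 2750983928712), (20,
       198839468376), (21, 3068599191336), (56, 3973841584), (59, 2464973156), (63, 39062083342),
       (74, 24597409542)]), (9, [(1, 36405200160), (3, 858812031360), (4, 763753915512), (7,
       5523636849360), (8, 5545305841296), (11, 5548001432760), (12, 5532656907648), (13,
       5517312382536), (20, 2758656191268), (50, 29045246136), (57, 38450511372), (58,
       6124286906), (61, 38847465334), (63, 19283809464), (78, 30867167967)]), (12, [(1,
       763753915512), (4, 234611662752), (7, 3667978571616), (8, 3667978571616), (11,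
       5545305841296), (13, 3068599191336), (14, 2469219811056), (15, 1768730705496), (19,
       198839468376), (20, 2750983928712), (56, 3973841584), (61, 2464973156), (64, 39062083342),
       (77, 24597409542)]), (3, [(1, 5548001432760), (4, 5545305841296), (5, 5523636849360), (8,
       763753915512), (11, 36405200160), (19, 2758656191268), (21, 5517312382536), (51,
       29045246136), (57, 38450511372), (59, 38847465334), (60, 6124286906), (64, 19283809464),
       (76, 30867167967)]), (1, [(4, 5532656907648), (5, 5517312382536), (11, 858812031360), (19,
       2758656191268), (21, 5523636849360), (52, 29045246136), (56, 38450511372), (59,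
       6124286906), (60, 38847465334), (63, 19283809464), (74, 30867167967)]), (8, [(6,
       2469219811056), (7, 3068599191336), (11, 5532656907648), (13, 3667978571616), (19,
       198839468376), (20, 2750983928712), (24, 1768730705496), (57, 3973841584), (58,
       2464973156), (63, 39062083342), (78, 24597409542)]), (4, [(5, 3068599191336), (6,
       2469219811056), (19, 2750983928712), (20, 198839468376), (21, 3667978571616), (24,
       1768730705496), (57, 3973841584), (60, 2464973156), (64, 39062083342), (76, 24597409542)]),
       (18, [(15, 5619332875392), (24, 5619332875392), (58, 12172737270), (59, 12172737270), (60,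
       12172737270), (61, 12172737270), (68, 6649668072), (70, 6649668072), (71, 6649668072), (72,
       6649668072)]), (11, [(7, 5517312382536), (13, 5523636849360), (20, 2758656191268), (53,
       29045246136), (56, 38450511372), (58, 38847465334), (61, 6124286906), (64, 19283809464),
       (77, 30867167967)]), (5, [(6, 1234609905528), (19, 3209481250164), (21, 2750983928712),
       (24, 566852805828), (53, 13550436056), (55, 2047110407), (61, 31750312120)]), (7, [(6,
       1234609905528), (13, 2750983928712), (20, 3209481250164), (24, 566852805828), (52,
       13550436056), (54, 2047110407), (59, 31750312120)]), (13, [(14, 1234609905528), (15,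
       566852805828), (20, 3209481250164), (51, 13550436056), (55, 2047110407), (60,
       31750312120)]), (21, [(14, 1234609905528), (15, 566852805828), (19, 3209481250164), (50,
       13550436056), (54, 2047110407), (58, 31750312120)]), (15, [(14, 1354358193984), (24,
       2809666437696), (52, 16066808178), (53, 16066808178)]), (24, [(6, 1354358193984), (50,
       16066808178), (51, 16066808178)]), (19, [(62, 45300748176), (66, 83689688588)]), (20, [(62,
       45300748176), (65, 83689688588)])] },
    { weight := 24,
      coweight := 6731340,
      decomposition := [(18, 1), (26, 1)],
      neighbours := [(2, [2, 1, 2, 1, 0, 2, 1, 2]), (2, [1, 2, 1, 0, 2, 1, 2]), (2, [1, 0, 2, 1,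
       2]), (2, [0, 2, 1, 2]), (2, [2, 1, 0, 2, 1, 2]), (2, [2, 0, 2, 1, 2]), (1, []), (1, [1]),
       (1, [2, 1, 2]), (1, [2]), (1, [1, 2, 1, 2]), (1, [2, 1, 2, 1, 2]), (1, [1, 2]), (1, [1, 2,
       1, 2, 1]), (1, [2, 1, 2, 1, 2, 1]), (1, [2, 1, 2, 1]), (1, [2, 1]), (1, [1, 2, 1]), (10,
       [1, 0, 2, 1, 2]), (10, [1, 2, 1, 0, 2, 1, 2]), (10, [2, 1, 0, 2, 1, 2]), (10, [0, 2, 1,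
       2]), (10, [2, 0, 2, 1, 2]), (10, [0, 2, 1, 2, 0]), (4, []), (4, [1]), (4, [2, 1, 2]), (4,
       [2]), (4, [2, 1]), (4, [0, 2, 1, 2]), (4, [2, 1, 2, 1]), (4, [1, 2]), (4, [1, 2, 1]), (4,
       [0, 2, 1, 2, 0]), (4, [2, 0, 2, 1, 2]), (4, [2, 0, 2, 1, 2, 0]), (5, []), (5, [2, 1]), (5,
       [1]), (5, [0, 2, 1]), (5, [2, 0, 2, 1]), (5, [0, 2, 1, 2, 0]), (3, []), (8, []), (8, [0]),
       (3, [2]), (3, [2, 1, 2]), (8, [2, 0]), (8, [2]), (8, [2, 1, 2, 0]), (3, [0, 2, 1, 2]), (8,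
       [1, 2, 0]), (3, [1, 2]), (3, [2, 0, 2, 1, 2])],
      scale := 164160,
      certificate := [(2, [(0, 243840), (1, 169920), (3, 169920), (4, 243840), (6, 46464), (7,
       30240), (8, 46464), (9, 30240), (10, 46464), (11, 30240), (12, 46464), (13, 30240), (14,
       46464), (15, 30240), (16, 46464), (19, 169920), (22, 243840), (24, 30240), (68, 660), (69,
       660), (70, 660), (71, 660), (72, 660), (73, 660)]), (1, [(0, 100800), (3, 230400), (4,
       216000), (6, 4872), (8, 15024), (10, 4872), (12, 4872), (14, 15024), (16, 4872), (19,
       230400), (22, 216000), (68, 500), (70, 500), (71, 500), (72, 500), (86, 135), (91, 135),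
       (96, 185), (102, 185)]), (3, [(0, 216000), (4, 100800), (6, 15024), (8, 4872), (10, 4872),
       (12, 15024), (14, 4872), (16, 4872), (19, 230400), (22, 216000), (68, 500), (69, 500), (71,
       500), (73, 500), (88, 135), (90, 135), (95, 185), (100, 185)]), (6, [(4, 5664), (5, 36768),
       (7, 32376), (8, 79584), (9, 43512), (10, 34944), (11, 13752), (12, 20064), (13, 13752),
       (14, 34944), (15, 43512), (16, 79584), (19, 4872), (24, 32376), (50, 802), (51, 1980), (52,
       802)]), (8, [(0, 5664), (7, 32376), (9, 32376), (10, 79584), (11, 43512), (12, 34944), (13,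
       13752), (14, 20064), (15, 13752), (16, 34944), (19, 4872), (24, 43512), (25, 36768), (51,
       802), (52, 1980), (55, 802)]), (10, [(7, 43512), (9, 32376), (11, 32376), (12, 79584), (13,
       43512), (14, 34944), (15, 13752), (16, 20064), (19, 15024), (20, 36768), (22, 5664), (24,
       13752), (52, 802), (53, 802), (55, 1980)]), (12, [(4, 5664), (7, 13752), (9, 43512), (11,
       32376), (13, 32376), (14, 79584), (15, 43512), (16, 34944), (19, 4872), (24, 13752), (28,
       36768), (53, 1980), (54, 802), (55, 802)]), (14, [(0, 5664), (7, 13752), (9, 13752), (11,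
       43512), (13, 32376), (15, 32376), (16, 79584), (19, 4872), (21, 36768), (24, 43512), (50,
       802), (53, 802), (54, 1980)]), (16, [(7, 43512), (9, 13752), (11, 13752), (13, 43512), (15,
       32376), (17, 36768), (19, 15024), (22, 5664), (24, 32376), (50, 1980), (51, 802), (54,
       802)]), (19, [(0, 216000), (4, 216000), (22, 100800), (69, 500), (70, 500), (72, 500), (73,
       500), (87, 135), (89, 135), (92, 185), (103, 185)]), (7, [(9, 27360), (11, 14880), (15,
       14880), (24, 27360), (58, 670), (66, 670), (76, 780), (78, 780)]), (13, [(9, 14880), (11,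
       27360), (15, 27360), (24, 14880), (60, 670), (67, 670), (79, 780), (82, 780)]), (0, [(4,
       134400), (22, 134400), (58, 220), (62, 220), (65, 220), (67, 220)]), (9, [(11, 27360), (24,
       14880), (61, 670), (65, 670), (80, 780), (84, 780)]), (15, [(11, 14880), (24, 27360), (57,
       670), (62, 670), (75, 780), (81, 780)]), (4, [(22, 134400), (59, 220), (60, 220), (63,
       220), (66, 220)]), (11, [(63, 670), (64, 670), (83, 780), (85, 780)]), (18, [(26, 108000),
       (97, 390), (98, 390), (101, 390)]), (22, [(56, 220), (57, 220), (61, 220), (64, 220)]),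
       (24, [(56, 670), (59, 670), (74, 780), (77, 780)]), (26, [(93, 390), (94, 390), (99,
       390)])] },
    { weight := 32,
      coweight := 5048505,
      decomposition := [(17, 1), (18, 2), (25, 1)],
      neighbours := [(1, []), (1, [1, 0]), (1, [2, 1, 2, 1, 0]), (1, [2, 1, 2, 1, 0, 2, 1, 2]),
       (1, [2, 0, 2, 1, 2, 1, 2, 0, 2]), (1, [2, 1, 2]), (1, [1, 0, 2, 1, 2]), (1, [1, 0, 2, 1, 2,
       1, 0]), (2, []), (2, [2, 1, 2, 1, 0, 2, 1, 2]), (2, [1]), (2, [2, 1, 2, 1, 0, 2, 1, 2, 1]),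
       (2, [1, 0, 2, 1, 2]), (2, [2, 1, 2]), (2, [2, 1, 2, 1]), (2, [1, 0, 2, 1, 2, 1]), (10, []),
       (10, [1, 0, 2, 1, 2]), (10, [1, 2, 1, 0, 2, 1, 2]), (10, [2, 1, 2]), (10, [0, 2, 1, 0, 2,
       1, 2]), (10, [1, 0]), (10, [2, 1, 2, 1, 0]), (10, [1, 2, 1, 0, 2, 1, 0]), (6, []), (6, [2,
       1, 2, 1, 0, 2, 1, 2]), (6, [2, 1, 2]), (6, [1, 0, 2, 1, 2]), (8, [0]), (8, [2, 1, 2, 0]),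
       (1, [0]), (1, [1]), (1, [2, 1, 2, 1, 0, 2, 1, 2, 0]), (1, [2, 1, 2, 1, 0, 2, 1, 2, 1]), (1,
       [1, 0, 2, 1, 2, 0]), (1, [2, 1, 2, 0]), (1, [2, 1, 2, 1]), (1, [1, 0, 2, 1, 2, 1])],
      scale := 1984512,
      certificate := [(4, [(9, 634880), (10, 131328), (11, 809856), (13, 809856), (14, 131328),
       (15, 634880), (20, 634880), (21, 634880), (59, 14592), (60, 14592), (62, 14592), (64,
       14592), (78, 1824), (79, 1824)]), (12, [(1, 634880), (2, 131328), (3, 809856), (5, 809856),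
       (6, 131328), (7, 634880), (19, 634880), (24, 634880), (58, 14592), (61, 14592), (63,
       14592), (65, 14592), (78, 1824), (79, 1824)]), (1, [(0, 452608), (2, 961248), (11, 51136),
       (13, 390592), (14, 523872), (18, 226304), (21, 139264), (53, 4896), (65, 11968), (73,
       7072)]), (6, [(7, 961248), (8, 1674432), (9, 523872), (15, 523872), (16, 1674432), (24,
       961248), (58, 3876), (63, 3876), (74, 969), (76, 969)]), (10, [(7, 523872), (8, 1674432),
       (9, 961248), (19, 523872), (20, 961248), (22, 1674432), (59, 3876), (64, 3876), (75, 969),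
       (76, 969)]), (2, [(0, 1674432), (19, 961248), (20, 523872), (21, 523872), (22, 1674432),
       (61, 3876), (65, 3876), (75, 969), (77, 969)]), (14, [(0, 1674432), (15, 961248), (16,
       1674432), (21, 961248), (24, 523872), (60, 3876), (62, 3876), (74, 969), (77, 969)]), (18,
       [(7, 226304), (9, 226304), (15, 226304), (17, 1984512), (19, 226304), (20, 226304), (21,
       226304), (24, 226304), (25, 1984512)]), (3, [(9, 51136), (11, 744192), (13, 744192), (15,
       51136), (20, 390592), (21, 390592), (82, 15504), (84, 15504)]), (5, [(9, 390592), (11,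
       744192), (13, 744192), (15, 390592), (20, 51136), (21, 51136), (81, 15504), (86, 15504)]),
       (7, [(8, 452608), (9, 139264), (11, 390592), (13, 51136), (51, 4896), (63, 11968), (69,
       7072)]), (19, [(11, 390592), (13, 51136), (20, 139264), (22, 452608), (56, 4896), (61,
       11968), (70, 7072)]), (24, [(11, 51136), (13, 390592), (15, 139264), (16, 452608), (52,
       4896), (58, 11968), (66, 7072)]), (9, [(8, 452608), (54, 4896), (64, 11968), (72, 7072)]),
       (15, [(16, 452608), (57, 4896), (60, 11968), (71, 7072)]), (20, [(22, 452608), (55, 4896),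
       (59, 11968), (68, 7072)]), (21, [(0, 452608), (50, 4896), (62, 11968), (67, 7072)]), (11,
       [(83, 15504), (85, 15504)]), (13, [(80, 15504), (87, 15504)]), (17, [(25, 1984512)])] },
    { weight := 20,
      coweight := 8077608,
      decomposition := [(0, 1), (1, 1), (2, 1), (3, 1), (4, 1), (5, 1), (6, 1), (7, 1), (8, 1),
       (25, 1)],
      neighbours := [(1, []), (1, [2, 1, 2, 1, 0]), (1, [2, 0, 2, 1, 2, 1, 2, 0, 2]), (1, [1, 0,
       2, 1, 2]), (1, [0, 2, 1, 2, 1, 0, 2, 1]), (1, [2, 1, 2, 1, 2]), (1, [1, 2, 1, 0, 2, 1, 2,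
       0]), (1, [2, 0]), (1, [1, 2, 1, 0, 2, 1]), (1, [0, 2]), (1, [1, 0, 2, 1, 0]), (1, [2, 1, 2,
       1, 0, 2, 0]), (1, [2, 0, 2, 1, 2, 1, 0]), (1, [1, 0, 2, 1, 0, 2, 0]), (1, [1, 2, 1, 2, 0,
       2, 1]), (1, [0, 2, 1, 0, 2, 1, 2]), (1, [0, 2, 1, 0, 2, 1, 0]), (1, [2, 1, 2, 1, 2, 0, 2]),
       (1, [2, 0, 2, 1, 2, 1, 2]), (1, [2, 0, 2, 0]), (10, []), (10, [1, 0, 2, 1, 2]), (10, [0, 2,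
       1, 0, 2, 1, 2]), (10, [0, 2]), (10, [2, 1, 2, 1, 0]), (10, [2, 0]), (10, [2, 1, 2, 1, 2]),
       (10, [1, 0, 2, 1, 0]), (10, [2, 0, 2, 0]), (10, [2, 1, 2, 1, 2, 0, 2]), (5, []), (5, [0]),
       (5, [2, 1]), (5, [1, 0]), (5, [2, 1, 2, 1, 0]), (5, [2, 0]), (5, [2, 0, 2, 1]), (5, [1, 0,
       2, 1, 0]), (5, [0, 2, 0]), (5, [0, 2, 1, 0])],
      scale := 1080,
      certificate := [(1, [(0, 360), (2, 360), (3, 720), (4, 360), (5, 720), (6, 360), (7, 720),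
       (8, 360), (11, 200), (14, 480), (22, 480), (25, 720), (54, 4), (63, 4), (74, 6), (84, 9)]),
       (13, [(0, 480), (4, 480), (7, 200), (10, 360), (11, 720), (12, 360), (14, 360), (15, 720),
       (16, 360), (17, 720), (20, 720), (22, 360), (60, 4), (65, 4), (78, 6), (88, 9)]), (3, [(0,
       360), (2, 360), (4, 360), (5, 720), (6, 360), (7, 720), (8, 360), (12, 480), (15, 200),
       (22, 480), (25, 720), (66, 4), (68, 4), (75, 6), (85, 9)]), (17, [(2, 480), (6, 480), (10,
       360), (11, 720), (12, 360), (14, 360), (15, 720), (16, 360), (20, 720), (22, 360), (25,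
       200), (50, 4), (52, 4), (76, 6), (86, 9)]), (5, [(0, 360), (2, 360), (4, 360), (6, 360),
       (7, 720), (8, 360), (12, 480), (16, 480), (20, 200), (25, 720), (56, 4), (57, 4), (79, 6),
       (89, 9)]), (11, [(4, 480), (8, 480), (10, 360), (12, 360), (14, 360), (15, 720), (16, 360),
       (20, 720), (22, 360), (58, 4), (61, 4), (77, 6), (87, 9)]), (7, [(0, 360), (2, 360), (4,
       360), (6, 360), (8, 360), (10, 480), (16, 480), (25, 720), (59, 4), (67, 4), (71, 6), (82,
       9)]), (15, [(0, 480), (6, 480), (10, 360), (12, 360), (14, 360), (16, 360), (20, 720), (22,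
       360), (64, 4), (69, 4), (72, 6), (83, 9)]), (20, [(2, 480), (8, 480), (10, 360), (12, 360),
       (14, 360), (16, 360), (22, 360), (55, 4), (62, 4), (70, 6), (80, 9)]), (25, [(0, 360), (2,
       360), (4, 360), (6, 360), (8, 360), (10, 480), (14, 480), (51, 4), (53, 4), (73, 6), (81,
       9)]), (0, [(10, 120), (12, 120), (14, 1920), (16, 120), (21, 960), (22, 120), (70, 3)]),
       (2, [(10, 120), (12, 120), (14, 120), (16, 120), (19, 960), (22, 1920), (78, 3)]), (4,
       [(10, 120), (12, 1920), (14, 120), (16, 120), (22, 120), (28, 960), (76, 3)]), (6, [(10,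
       120), (12, 120), (14, 120), (16, 1920), (22, 120), (24, 960), (77, 3)]), (8, [(9, 960),
       (10, 1920), (12, 120), (14, 120), (16, 120), (22, 120), (72, 3)]), (10, [(9, 960), (75,
       3)]), (12, [(28, 960), (73, 3)]), (14, [(21, 960), (79, 3)]), (16, [(24, 960), (74, 3)]),
       (22, [(19, 960), (71, 3)])] },
    { weight := 40,
      coweight := 4038804,
      decomposition := [(20, 1), (23, 1)],
      neighbours := [(1, [2, 1, 2, 1, 0]), (1, [0, 2, 1, 2, 1, 0, 2, 1]), (11, [2, 1, 2]), (11,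
       [0, 2, 1, 2, 1, 0, 2, 0]), (2, []), (2, [1, 2, 1, 0, 2, 1]), (10, [1, 2, 1, 0, 2, 1, 2]),
       (10, [2]), (5, []), (1, []), (1, [2, 1, 2]), (1, [1, 2, 1, 0, 2, 1]), (1, [0, 2, 1, 2, 1,
       0, 2, 0]), (4, [2]), (11, [1, 2]), (0, [2, 1, 2, 1, 0, 2, 1, 2]), (0, [2, 1, 2, 1, 0, 2,
       1]), (2, [1, 2, 1, 0, 2, 1, 2]), (2, [2]), (12, []), (12, [2]), (3, []), (3, [1, 2, 1, 0,
       2]), (1, [2, 1, 2, 1, 0, 2, 1, 2]), (1, [2, 1, 2, 1, 0, 2, 1]), (1, [1, 2]), (1, [1, 2, 1,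
       0]), (9, []), (10, [2, 1, 2]), (10, [0, 2]), (10, [2, 1, 2, 1, 0]), (10, [1, 2, 0, 2, 1]),
       (10, [0, 2, 1, 2, 0]), (10, [2, 1, 2, 0, 2, 1]), (10, [2, 0, 2])],
      scale := 451508878374400,
      certificate := [(14, [(0, 15033692784160), (2, 92250042099920), (3, 91232495582960), (4,
       41607118286800), (6, 41607118286800), (7, 91232495582960), (8, 92250042099920), (9,
       7655303427680), (10, 186136614977040), (11, 267521460317580), (12, 233174916321480), (13,
       232223217273460), (15, 232223217273460), (16, 233174916321480), (17, 267521460317580), (19,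
       7655303427680), (21, 358440570885880), (22, 186136614977040), (58, 7405267517658), (67,
       2002233847238), (68, 2002233847238)]), (5, [(1, 55626450510400), (3, 9424753635000), (4,
       48651672986400), (6, 48651672986400), (7, 9424753635000), (9, 3900142103000), (10,
       23790159091600), (11, 8855633342600), (12, 74919319888600), (13, 51155557246200), (15,
       51155557246200), (16, 74919319888600), (17, 8855633342600), (19, 3900142103000), (22,
       23790159091600), (25, 55626450510400), (63, 706856522625), (64, 623839821770), (82,
       2274391738080), (83, 2274391738080)]), (12, [(0, 27413638054880), (3, 62189123827600), (4,
       205292557562400), (6, 77667504530000), (7, 14529836875400), (9, 45467336610080), (10,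
       190686094404960), (11, 137982713564080), (13, 127736487728080), (15, 231546399188720), (16,
       140106608832960), (17, 98986151750640), (19, 64294203512000), (20, 22761518850840), (21,
       105079956624720), (25, 98591056252920), (57, 4345484915695), (66, 935776084397)]), (16,
       [(0, 27413638054880), (1, 98591056252920), (3, 14529836875400), (4, 77667504530000), (6,
       205292557562400), (7, 62189123827600), (9, 64294203512000), (11, 98986151750640), (13,
       231546399188720), (15, 127736487728080), (17, 137982713564080), (19, 45467336610080), (20,
       22761518850840), (21, 105079956624720), (22, 190686094404960), (56, 4345484915695), (65,
       935776084397)]), (4, [(0, 1396207120000), (1, 66984470660800), (6, 119208662865600), (7,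
       38982601812000), (8, 18360872191200), (9, 3850477800400), (13, 57024281714400), (19,
       9961813030400), (20, 92186966564000), (22, 41243459241600), (25, 54845073575600), (57,
       4875962634620), (68, 169314955040), (70, 4067477888320), (81, 1260597383430)]), (6, [(0,
       1396207120000), (1, 54845073575600), (2, 18360872191200), (3, 38982601812000), (9,
       9961813030400), (10, 41243459241600), (15, 57024281714400), (19, 3850477800400), (20,
       92186966564000), (25, 66984470660800), (56, 4875962634620), (67, 169314955040), (69,
       4067477888320), (81, 1260597383430)]), (9, [(1, 11823350369600), (3, 18654854033200), (7,
       108203694768400), (8, 70494584190800), (10, 118271063002400), (11, 95689239291800), (13,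
       23158891771400), (17, 237993167735400), (19, 26649791476000), (22, 11974803640800), (25,
       45425855937000), (50, 4181908780280), (77, 366874695880)]), (15, [(1, 13329080503200), (7,
       20435521075200), (10, 67243821598800), (11, 192794381395000), (13, 312155506093200), (17,
       200645699346400), (19, 23158891771400), (21, 215300374011800), (22, 173049549934800), (58,
       4523804623800), (71, 1367049232780), (75, 1918183277780)]), (3, [(1, 117455813860000), (2,
       81019060337600), (13, 20435521075200), (19, 108203694768400), (20, 7434506032800), (21,
       23045025311000), (22, 162038120675200), (25, 34306617329600), (62, 1416532808460), (80,
       532995829520), (84, 3214589917000)]), (7, [(1, 34306617329600), (8, 81019060337600), (10,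
       162038120675200), (19, 18654854033200), (20, 7434506032800), (21, 23045025311000), (25,
       117455813860000), (60, 1416532808460), (78, 3214589917000), (79, 532995829520)]), (2, [(1,
       269557539328000), (17, 19795878748800), (19, 70494584190800), (21, 189888342859600), (22,
       172968918152800), (25, 44966533920000), (53, 561039359650), (61, 4015787646640), (74,
       532995829520)]), (13, [(10, 173049549934800), (11, 200645699346400), (17, 192794381395000),
       (21, 215300374011800), (22, 67243821598800), (25, 13329080503200), (58, 4523804623800),
       (72, 1367049232780), (76, 1918183277780)]), (8, [(1, 44966533920000), (10,
       172968918152800), (11, 19795878748800), (21, 189888342859600), (25, 269557539328000), (52,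
       561039359650), (59, 4015787646640), (73, 532995829520)]), (19, [(1, 45425855937000), (10,
       11974803640800), (11, 237993167735400), (17, 95689239291800), (22, 118271063002400), (25,
       11823350369600), (51, 4181908780280), (77, 366874695880)]), (11, [(10, 189671706501200),
       (17, 63959499542400), (21, 74619416132800), (51, 1095077503520), (53, 1644891315375)]), (1,
       [(22, 19235386478000), (25, 23646700739200), (53, 1387631002065), (55, 4548783476160)]),
       (17, [(21, 74619416132800), (22, 189671706501200), (50, 1095077503520), (52,
       1644891315375)]), (21, [(58, 4312259520030), (63, 1859657886625), (77, 2190155007040)]),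
       (25, [(10, 19235386478000), (52, 1387631002065), (54, 4548783476160)]), (20, [(23,
       225754439187200)])] },
    { weight := 56,
      coweight := 2884860,
      decomposition := [(17, 1), (18, 2), (27, 1)],
      neighbours := [(1, []), (1, [1, 0]), (4, [2, 1, 2]), (10, [1, 0, 2, 1, 2]), (10, [2, 1, 2]),
       (6, []), (8, []), (5, [2, 1]), (2, []), (2, [1]), (2, [1, 0, 2, 1, 2]), (2, [2, 1, 2]), (1,
       [2, 1, 2]), (1, [1, 0, 2, 1, 2]), (10, [2, 1]), (4, []), (11, [0]), (4, [1, 0]), (3, []),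
       (7, []), (7, [0]), (2, [2, 1, 2, 1, 0, 2, 1, 2]), (2, [2, 1, 2, 1, 0, 2, 1, 2, 1])],
      scale := 7448338437120,
      certificate := [(0, [(1, 5326249838112), (2, 11169448851456), (3, 10720018606080), (4,
       9061377805536), (5, 7448338437120), (6, 7448338437120), (8, 1394631684096), (9,
       1309429066624), (10, 2418010241024), (11, 704392991232), (12, 54047514304), (13,
       13496833616), (15, 78859662336), (17, 1214178135296), (19, 4965558958080), (24,
       7448338437120), (52, 28678057968), (54, 3191250944), (56, 5412101968), (62, 9740536960)]),
       (2, [(1, 7706813024736), (3, 7409955114240), (4, 11168687844608), (5, 12171552583680), (6,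
       16228736778240), (8, 2418010241024), (9, 2015008732800), (10, 2538301280256), (11,
       1045737810432), (12, 604756805184), (13, 511562617776), (14, 1119899870208), (16,
       1998089856000), (17, 655117602048), (19, 5254768253952), (24, 20285920972800), (27,
       567360993024), (56, 99672600384), (57, 54664251264)]), (4, [(1, 11486978914096), (3,
       5622727245184), (5, 3724169218560), (6, 7448338437120), (8, 54047514304), (10,
       604756805184), (12, 435136351104), (13, 615265143696), (14, 2171402968896), (17,
       430615555552), (19, 8454748468880), (24, 11172507655680), (56, 4206570816), (57,
       25737144412), (59, 9859875732), (60, 11557833798), (64, 6085471392), (71, 11729131414)]),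
       (5, [(1, 10806820344432), (3, 8124896035200), (6, 4851358684704), (8, 13496833616), (10,
       511562617776), (11, 216782828640), (12, 615265143696), (13, 1650095104896), (14,
       3188643867360), (16, 165924845856), (17, 876356239248), (18, 795813690672), (19,
       7448338437120), (24, 8094895593120), (53, 28711103148), (66, 7756630623), (69,
       30861377190)]), (8, [(1, 1309429066624), (3, 704392991232), (9, 5326249838112), (10,
       11169448851456), (11, 10720018606080), (12, 9061377805536), (13, 7448338437120), (14,
       7448338437120), (15, 7448338437120), (17, 1214178135296), (20, 4965558958080), (24,
       78859662336), (52, 28678057968), (53, 3191250944), (56, 5412101968), (63, 9740536960)]),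
       (9, [(1, 1132199437824), (3, 478790807040), (6, 364292643456), (10, 7706813024736), (11,
       10812004204176), (12, 11486978914096), (13, 10806820344432), (14, 12460341186720), (15,
       14113862029008), (16, 870705997056), (17, 299066294016), (20, 6675516454320), (50,
       2188719288), (56, 55028445696), (57, 45343145232)]), (10, [(1, 2015008732800), (3,
       1045737810432), (6, 1119899870208), (11, 7409955114240), (12, 11168687844608), (13,
       12171552583680), (14, 16228736778240), (15, 20285920972800), (16, 1998089856000), (17,
       655117602048), (20, 5254768253952), (27, 567360993024), (56, 99672600384), (57,
       54664251264)]), (11, [(1, 478790807040), (6, 1472335893504), (12, 5622727245184), (13,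
       8124896035200), (14, 12154224552960), (15, 16183553070720), (16, 1030864030560), (17,
       545882346912), (20, 8358875253120), (56, 57698835600), (57, 51298039380), (58, 1182839280),
       (68, 10020919020)]), (3, [(1, 10812004204176), (6, 12154224552960), (13, 216782828640),
       (14, 1472335893504), (16, 1030864030560), (17, 545882346912), (19, 8358875253120), (24,
       16183553070720), (56, 57698835600), (57, 51298039380), (59, 1182839280), (68,
       10020919020)]), (12, [(6, 2171402968896), (13, 3724169218560), (14, 7448338437120), (15,
       11172507655680), (17, 430615555552), (20, 8454748468880), (56, 4206570816), (57,
       25737144412), (58, 9859875732), (61, 11557833798), (64, 6085471392), (72, 11729131414)]),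
       (13, [(6, 3188643867360), (14, 4851358684704), (15, 8094895593120), (16, 165924845856),
       (17, 876356239248), (18, 795813690672), (20, 7448338437120), (54, 28711103148), (66,
       7756630623), (70, 30861377190)]), (1, [(6, 12460341186720), (14, 364292643456), (16,
       870705997056), (17, 299066294016), (19, 6675516454320), (24, 14113862029008), (51,
       2188719288), (56, 55028445696), (57, 45343145232)]), (15, [(6, 1939427739648), (14,
       3724169218560), (16, 1105335157248), (17, 2114772879744), (20, 9931117916160), (24,
       1216691933184), (51, 23382446976)]), (17, [(16, 6198654196224), (18, 3074443593984), (19,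
       145323997056), (20, 145323997056), (24, 2114772879744), (52, 11157895008)]), (6, [(14,
       7312283854848), (19, 8689728176640), (24, 3724169218560), (53, 14701075200), (55,
       51801946560)]), (14, [(20, 8689728176640), (24, 1939427739648), (54, 14701075200), (55,
       51801946560)]), (27, [(50, 26957129472), (51, 26957129472), (55, 541618560), (68,
       6023572128)]), (18, [(16, 6148887187968), (53, 39052632528), (54, 39052632528)]), (19,
       [(24, 9931117916160), (57, 38663827776), (67, 13919596992)]), (20, [(57, 38663827776), (65,
       13919596992)]), (24, [(16, 1105335157248), (50, 23382446976)])] },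
    { weight := 22,
      coweight := 7343280,
      decomposition := [(1, 1), (2, 2), (3, 2), (4, 2), (5, 1), (19, 1), (28, 1)],
      neighbours := [(2, []), (2, [1, 2, 1, 0, 2, 1, 2]), (2, [2, 1, 2]), (2, [0, 2, 1, 2]), (2,
       [2, 1, 2, 1, 2, 0, 2, 1]), (2, [2, 1, 2, 1, 0, 2, 1]), (2, [0, 2, 1, 2, 1, 0, 2, 1]), (2,
       [2, 1, 2, 1, 2, 1]), (2, [1, 0, 2, 1]), (2, [1, 2, 1]), (2, [0, 2, 1, 2, 1, 2, 1]), (2, [1,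
       2, 0, 2, 1]), (10, []), (10, [1, 0, 2, 1, 2]), (10, [1, 2, 1, 0, 2, 1, 2]), (10, [0]), (10,
       [2, 1, 2]), (10, [2]), (10, [1, 2, 1, 2]), (10, [0, 2, 1, 2]), (10, [1, 0, 2, 1, 0, 2, 1,
       2]), (10, [0, 2]), (10, [2, 1]), (10, [0, 2, 1]), (10, [1, 0, 2, 1, 0]), (10, [1, 2, 0, 2,
       1]), (10, [0, 2, 1, 2, 0]), (10, [2, 1, 2, 0, 2, 1]), (10, [1, 0, 2, 1, 0, 2]), (10, [1, 2,
       1, 0]), (10, [2, 1, 2, 0]), (10, [2, 1, 2, 1, 0, 2, 1, 0]), (10, [1, 2, 0, 2, 1, 0]), (10,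
       [2, 1, 2, 0, 2]), (10, [2, 0, 2, 1, 2, 1, 0, 2]), (10, [1, 2, 1, 0, 2])],
      scale := 142296,
      certificate := [(3, [(1, 112948), (2, 94864), (4, 94864), (5, 112948), (8, 36652), (9,
       12936), (10, 36652), (14, 36652), (15, 12936), (16, 36652), (19, 112948), (28, 112948),
       (62, 147), (65, 392), (66, 147), (67, 392), (68, 392), (70, 147), (72, 392), (73, 147),
       (74, 147), (75, 392), (77, 147), (78, 392), (79, 392), (80, 392), (81, 147), (82, 147)]),
       (9, [(2, 36652), (4, 36652), (7, 112948), (8, 94864), (10, 94864), (11, 112948), (14,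
       36652), (15, 12936), (16, 36652), (20, 112948), (25, 112948), (62, 392), (63, 392), (64,
       147), (65, 147), (69, 147), (71, 392), (72, 147), (73, 392), (74, 392), (75, 147), (76,
       392), (79, 147), (82, 392), (83, 147), (84, 147), (85, 392)]), (15, [(2, 36652), (4,
       36652), (8, 36652), (10, 36652), (13, 112948), (14, 94864), (16, 94864), (17, 112948), (21,
       112948), (24, 112948), (63, 147), (64, 392), (66, 392), (67, 147), (68, 147), (69, 392),
       (70, 392), (71, 147), (76, 147), (77, 392), (78, 147), (80, 147), (81, 392), (83, 392),
       (84, 392), (85, 147)]), (2, [(1, 59048), (4, 94864), (5, 106480), (7, 16544), (8, 60368),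
       (10, 60368), (11, 16544), (13, 16544), (14, 60368), (16, 60368), (17, 13640), (19, 59048),
       (20, 13640), (21, 13640), (24, 16544), (25, 13640), (28, 106480), (65, 1078), (78, 1078),
       (79, 1078), (80, 1078)]), (4, [(1, 106480), (5, 59048), (7, 13640), (8, 60368), (10,
       60368), (11, 13640), (13, 13640), (14, 60368), (16, 60368), (17, 16544), (19, 106480), (20,
       16544), (21, 16544), (24, 13640), (25, 16544), (28, 59048), (67, 1078), (68, 1078), (72,
       1078), (75, 1078)]), (8, [(1, 13640), (5, 13640), (7, 59048), (10, 94864), (11, 106480),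
       (13, 16544), (14, 60368), (16, 60368), (17, 16544), (19, 16544), (20, 106480), (21, 13640),
       (24, 13640), (25, 59048), (28, 16544), (63, 1078), (71, 1078), (73, 1078), (82, 1078)]),
       (10, [(1, 16544), (5, 16544), (7, 106480), (11, 59048), (13, 13640), (14, 60368), (16,
       60368), (17, 13640), (19, 13640), (20, 59048), (21, 16544), (24, 16544), (25, 106480), (28,
       13640), (62, 1078), (74, 1078), (76, 1078), (85, 1078)]), (14, [(1, 13640), (5, 16544), (7,
       16544), (11, 13640), (13, 59048), (16, 94864), (17, 106480), (19, 16544), (20, 16544), (21,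
       59048), (24, 106480), (25, 13640), (28, 13640), (66, 1078), (69, 1078), (81, 1078), (84,
       1078)]), (16, [(1, 16544), (5, 13640), (7, 13640), (11, 16544), (13, 106480), (17, 59048),
       (19, 13640), (20, 13640), (21, 106480), (24, 59048), (25, 16544), (28, 16544), (64, 1078),
       (70, 1078), (77, 1078), (83, 1078)]), (1, [(0, 25168), (5, 82764), (19, 59048), (28,
       82764), (55, 506), (60, 308), (61, 506), (79, 132), (80, 132)]), (7, [(6, 25168), (11,
       82764), (20, 82764), (25, 59048), (52, 308), (58, 506), (60, 506), (63, 132), (82, 132)]),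
       (13, [(12, 25168), (17, 82764), (21, 59048), (24, 82764), (54, 506), (59, 308), (60, 506),
       (69, 132), (81, 132)]), (5, [(6, 25168), (19, 82764), (28, 59048), (53, 308), (57, 506),
       (59, 506), (68, 132), (75, 132)]), (11, [(12, 25168), (20, 59048), (25, 82764), (56, 506),
       (57, 308), (61, 506), (74, 132), (76, 132)]), (17, [(21, 82764), (22, 25168), (24, 59048),
       (52, 506), (53, 506), (61, 308), (77, 132), (83, 132)]), (19, [(22, 25168), (28, 82764),
       (54, 506), (56, 308), (58, 506), (65, 132), (78, 132)]), (20, [(22, 25168), (25, 82764),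
       (51, 506), (55, 308), (59, 506), (62, 132), (85, 132)]), (21, [(0, 25168), (24, 82764),
       (51, 506), (57, 506), (58, 308), (66, 132), (84, 132)]), (24, [(6, 25168), (50, 308), (55,
       506), (56, 506), (64, 132), (70, 132)]), (25, [(0, 25168), (50, 506), (53, 506), (54, 308),
       (71, 132), (73, 132)]), (28, [(12, 25168), (50, 506), (51, 308), (52, 506), (67, 132), (72,
       132)])] }]

/-- The linear forms defined by the simple roots. -/
def rootForms : List (List ℤ) := simpleRoots.map lorentzForm

/-- The Lorentzian quadratic form in twenty variables as a sum of products of linear forms. -/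
def lorentzProducts : List (List ℤ × List ℤ) :=
  (List.range 20).map fun i =>
    ((List.range 20).map fun j => if j = i then (if j = 0 then 1 else -1) else 0,
      (List.range 20).map fun j => if j = i then 1 else 0)

/-- The chart with index `k`. -/
def chart (k : ℕ) : CuspChart := cuspCharts.getD k ⟨0, 0, [], [], 0, []⟩

/-- The linear form of the cusp of the chart `k`. -/
def cuspForm (k : ℕ) : List ℤ := combForm rootForms (chart k).decomposition

/-- The combination of simple roots obtained from `T` by a word in the chamber symmetries. -/
def permuteRoots (T : List (ℕ × ℕ)) : List ℕ → List (ℕ × ℕ)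
  | [] => T
  | s :: w => (permuteRoots T w).map fun t => ((rootPermutation s).getD t.1 t.1, t.2)

/-- The linear form comparing the cusp of the chart `k` to one of its neighbours. -/
def comparisonForm (k : ℕ) (c : ℕ × List ℕ) : List ℤ :=
  addForm (smulForm (chart k).weight
      (combForm rootForms (permuteRoots (chart c.1).decomposition c.2)))
    (smulForm (-(chart c.1).weight) (cuspForm k))

/-- The linear forms that are nonnegative on the chart `k`. -/
def chartForms (k : ℕ) : List (List ℤ) :=
  rootForms ++ (chart k).neighbours.map (comparisonForm k)

/-- The products of nonnegative linear forms of the certificate of the chart `k`. -/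
def certificateProducts (k : ℕ) : List (List ℤ × List ℤ) :=
  (chart k).certificate.map fun t =>
    ((chartForms k).getD t.1 [], combForm (chartForms k) t.2)

section FormLists

theorem evalForm_addForm (f g : List ℤ) (u : ℕ → ℤ) :
    evalForm (addForm f g) u = evalForm f u + evalForm g u := by
  induction f, g using addForm.induct generalizing u with
  | case1 g => simp [addForm, evalForm]
  | case2 a f => simp [addForm, evalForm]
  | case3 a f b g ih => simp only [addForm, evalForm, ih]; ring

theorem evalForm_smulForm (c : ℤ) (f : List ℤ) (u : ℕ → ℤ) :
    evalForm (smulForm c f) u = c * evalForm f u := by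
  induction f generalizing u with
  | nil => simp [smulForm, evalForm]
  | cons a f ih => simp only [smulForm, evalForm, ih]; ring

theorem evalQuad_addQuad (P Q : List (List ℤ)) (u : ℕ → ℤ) :
    evalQuad (addQuad P Q) u = evalQuad P u + evalQuad Q u := by
  induction P, Q using addQuad.induct generalizing u with
  | case1 Q => simp [addQuad, evalQuad]
  | case2 f P => simp [addQuad, evalQuad]
  | case3 f P g Q ih => simp only [addQuad, evalQuad, evalForm_addForm, ih]; ring

theorem evalQuad_mulForm (f g : List ℤ) (u : ℕ → ℤ) :
    evalQuad (mulForm f g) u = evalForm f u * evalForm g u := by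
  induction f generalizing g u with
  | nil => simp [mulForm, evalQuad, evalForm]
  | cons a f ih =>
    cases g with
    | nil => simp [mulForm, evalQuad, evalForm]
    | cons b g =>
      simp only [mulForm, evalQuad, evalForm, evalForm_addForm, evalForm_smulForm, ih]
      ring

theorem evalQuad_expandProducts (E : List (List ℤ × List ℤ)) (u : ℕ → ℤ) :
    evalQuad (expandProducts E) u =
      (E.map fun p => evalForm p.1 u * evalForm p.2 u).sum := by
  induction E with
  | nil => simp [expandProducts, evalQuad]
  | cons p E ih =>
    simp only [expandProducts, evalQuad_addQuad, evalQuad_mulForm, ih, List.map_cons,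
      List.sum_cons]

theorem evalQuad_expandProducts_smulForm (c : ℤ) (E : List (List ℤ × List ℤ)) (u : ℕ → ℤ) :
    evalQuad (expandProducts (E.map fun p => (smulForm c p.1, p.2))) u =
      c * evalQuad (expandProducts E) u := by
  simp only [evalQuad_expandProducts, List.map_map, ← List.sum_map_mul_left]
  refine congrArg List.sum (List.map_congr_left fun p _ => ?_)
  simp only [Function.comp_apply, evalForm_smulForm, mul_assoc]

/-- The linear substitution whose rows are the forms in `A`. -/
def substitute (A : List (List ℤ)) (u : ℕ → ℤ) : ℕ → ℤ :=
  fun i => evalForm (A.getD i []) u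

theorem evalForm_compForm (f : List ℤ) (A : List (List ℤ)) (u : ℕ → ℤ) :
    evalForm (compForm f A) u = evalForm f (substitute A u) := by
  have hnil : ∀ f : List ℤ, evalForm f (substitute [] u) = 0 := fun f => by
    have : substitute [] u = fun _ => 0 := funext fun i => by simp [substitute, evalForm]
    rw [this]
    induction f with
    | nil => rfl
    | cons a f ih => simp [evalForm, ih]
  induction f generalizing A with
  | nil => simp [compForm, evalForm]
  | cons a f ih =>
    cases A with
    | nil => rw [hnil]; rfl
    | cons r A =>
      have hs : (fun i => substitute (r :: A) u (i + 1)) = substitute A u :=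
        funext fun i => by simp [substitute]
      have h0 : substitute (r :: A) u 0 = evalForm r u := by simp [substitute]
      rw [evalForm, hs, h0, ← ih, compForm]
      split_ifs with ha
      · simp [ha]
      · rw [evalForm_addForm, evalForm_smulForm]

theorem evalForm_map_neg (f : List ℤ) (u : ℕ → ℤ) :
    evalForm (f.map fun x => -x) u = -evalForm f u := by
  induction f generalizing u with
  | nil => simp [evalForm]
  | cons a f ih => simp only [List.map_cons, evalForm, ih]; ring

theorem evalForm_eq_sum {n : ℕ} (f : List ℤ) (hf : f.length = n) (u : ℕ → ℤ) :
    evalForm f u = ∑ i : Fin n, f.getD i 0 * u i := by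
  induction f generalizing n u with
  | nil => subst hf; simp [evalForm]
  | cons a f ih =>
    subst hf
    rw [evalForm, ih rfl, List.length_cons, Fin.sum_univ_succ]
    simp

theorem evalForm_lorentzForm {m : ℕ} (f : List ℤ) (hf : f.length = m + 1) (u : ℕ → ℤ) :
    evalForm (lorentzForm f) u =
      lorentz (fun i : Fin (m + 1) => f.getD i 0) fun i => u i := by
  cases f with
  | nil => simp at hf
  | cons a f =>
    rw [lorentzForm, evalForm, evalForm_map_neg, evalForm_eq_sum f (by simpa using hf)]
    simp [lorentz, sub_eq_add_neg]

theorem evalForm_map_range (n : ℕ) (g : ℕ → ℤ) (u : ℕ → ℤ) :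
    evalForm ((List.range n).map g) u = ∑ j : Fin n, g j * u j := by
  rw [evalForm_eq_sum (n := n) _ (by simp)]
  refine Finset.sum_congr rfl fun j _ => ?_
  rw [List.getD_eq_getElem _ _ (by simp)]
  simp

theorem evalForm_getD_nonneg {F : List (List ℤ)} {u : ℕ → ℤ}
    (hF : ∀ f ∈ F, 0 ≤ evalForm f u) (i : ℕ) : 0 ≤ evalForm (F.getD i []) u := by
  by_cases hi : i < F.length
  · rw [List.getD_eq_getElem _ _ hi]
    exact hF _ (List.getElem_mem hi)
  · rw [List.getD_eq_default _ _ (not_lt.1 hi)]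
    exact le_rfl

theorem evalForm_combForm_nonneg {F : List (List ℤ)} {u : ℕ → ℤ}
    (hF : ∀ f ∈ F, 0 ≤ evalForm f u) (T : List (ℕ × ℕ)) :
    0 ≤ evalForm (combForm F T) u := by
  induction T with
  | nil => simp [combForm, evalForm]
  | cons t T ih =>
    rw [combForm, evalForm_addForm, evalForm_smulForm]
    refine add_nonneg (mul_nonneg (Int.natCast_nonneg _) ?_) ih
    exact evalForm_getD_nonneg hF _

end FormLists

section ChamberCharts

/-- The coordinate change given by a word in the chamber symmetries. -/
def applyWord : List ℕ → (ℕ → ℤ) → ℕ → ℤ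
  | [], u => u
  | s :: w, u => applyWord w (substitute (chamberSymmetry s) u)

theorem compForm_rootForms : ∀ s < 3, ∀ i < 50,
    compForm (rootForms.getD i []) (chamberSymmetry s) =
      rootForms.getD ((rootPermutation s).getD i i) [] := by
  decide +kernel

theorem expandProducts_compForm_lorentzProducts : ∀ s < 3,
    expandProducts (lorentzProducts.map fun p =>
      (compForm p.1 (chamberSymmetry s), compForm p.2 (chamberSymmetry s))) =
    expandProducts lorentzProducts := by
  decide +kernel

theorem chamberSymmetry_two_add (s : ℕ) : chamberSymmetry (s + 2) = chamberSymmetry 2 := rfl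

theorem rootPermutation_two_add (s : ℕ) : rootPermutation (s + 2) = rootPermutation 2 := rfl

theorem evalForm_rootForms_substitute (s i : ℕ) (u : ℕ → ℤ) :
    evalForm (rootForms.getD i []) (substitute (chamberSymmetry s) u) =
      evalForm (rootForms.getD ((rootPermutation s).getD i i) []) u := by
  wlog hs : s < 3 generalizing s
  · obtain ⟨t, rfl⟩ := Nat.exists_eq_add_of_le' (show 2 ≤ s by omega)
    rw [chamberSymmetry_two_add, rootPermutation_two_add]
    exact this 2 (by norm_num)
  by_cases hi : i < 50
  · rw [← compForm_rootForms s hs i hi, evalForm_compForm]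
  · have hp : ∀ s < 3, (rootPermutation s).length = 50 := by decide +kernel
    have hr : rootForms.length = 50 := by decide +kernel
    rw [List.getD_eq_default (rootPermutation s) _ (by rw [hp s hs]; omega),
      List.getD_eq_default _ _ (by omega)]
    rfl

theorem evalQuad_lorentzProducts_substitute (s : ℕ) (u : ℕ → ℤ) :
    evalQuad (expandProducts lorentzProducts) (substitute (chamberSymmetry s) u) =
      evalQuad (expandProducts lorentzProducts) u := by
  wlog hs : s < 3 generalizing s
  · obtain ⟨t, rfl⟩ := Nat.exists_eq_add_of_le' (show 2 ≤ s by omega)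
    rw [chamberSymmetry_two_add]
    exact this 2 (by norm_num)
  conv_rhs => rw [← expandProducts_compForm_lorentzProducts s hs]
  simp only [evalQuad_expandProducts, List.map_map]
  refine congrArg List.sum (List.map_congr_left fun p _ => ?_)
  simp only [Function.comp_apply, evalForm_compForm]

theorem evalQuad_lorentzProducts_applyWord (w : List ℕ) (u : ℕ → ℤ) :
    evalQuad (expandProducts lorentzProducts) (applyWord w u) =
      evalQuad (expandProducts lorentzProducts) u := by
  induction w generalizing u with
  | nil => rfl
  | cons s w ih => rw [applyWord, ih, evalQuad_lorentzProducts_substitute]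

theorem evalForm_permuteRoots (T : List (ℕ × ℕ)) (w : List ℕ) (u : ℕ → ℤ) :
    evalForm (combForm rootForms (permuteRoots T w)) u =
      evalForm (combForm rootForms T) (applyWord w u) := by
  induction w generalizing u with
  | nil => rfl
  | cons s w ih =>
    rw [applyWord, ← ih, permuteRoots]
    induction permuteRoots T w with
    | nil => rfl
    | cons t T ih =>
      simp only [List.map_cons, combForm, evalForm_addForm, evalForm_smulForm, ih,
        evalForm_rootForms_substitute]

theorem rootForms_nonneg_applyWord {u : ℕ → ℤ} (hu : ∀ f ∈ rootForms, 0 ≤ evalForm f u)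
    (w : List ℕ) : ∀ f ∈ rootForms, 0 ≤ evalForm f (applyWord w u) := by
  induction w generalizing u with
  | nil => exact hu
  | cons s w ih =>
    refine ih fun f hf => ?_
    obtain ⟨i, hi, rfl⟩ := List.getElem_of_mem hf
    rw [← List.getD_eq_getElem _ [] hi, evalForm_rootForms_substitute]
    exact evalForm_getD_nonneg hu _

theorem expandProducts_certificateProducts : ∀ k < 13,
    expandProducts (certificateProducts k) =
      expandProducts (lorentzProducts.map fun p => (smulForm (chart k).scale p.1, p.2)) := by
  decide +kernel

theorem chart_scale_pos : ∀ k < 13, 0 < (chart k).scale := by decide +kernel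

theorem chart_weight_mul_coweight : ∀ k < 13,
    (chart k).weight * (chart k).coweight = 161552160 := by
  decide +kernel

theorem chart_neighbours_lt : ∀ k < 13, ∀ c ∈ (chart k).neighbours, c.1 < 13 := by
  decide +kernel

theorem evalQuad_nonneg_of_chartForms {k : ℕ} (hk : k < 13) {u : ℕ → ℤ}
    (hu : ∀ f ∈ chartForms k, 0 ≤ evalForm f u) :
    0 ≤ evalQuad (expandProducts lorentzProducts) u := by
  have hD : (0 : ℤ) < (chart k).scale := by exact_mod_cast chart_scale_pos k hk
  refine nonneg_of_mul_nonneg_right ?_ hD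
  rw [← evalQuad_expandProducts_smulForm, ← expandProducts_certificateProducts k hk,
    evalQuad_expandProducts]
  refine List.sum_nonneg fun x hx => ?_
  simp only [certificateProducts, List.map_map, List.mem_map, Function.comp_apply] at hx
  obtain ⟨t, -, rfl⟩ := hx
  exact mul_nonneg (evalForm_getD_nonneg hu _) (evalForm_combForm_nonneg hu _)

/-- The chamber is contained in the closed light cone. -/
theorem evalQuad_nonneg_of_rootForms {u : ℕ → ℤ} (hu : ∀ f ∈ rootForms, 0 ≤ evalForm f u) :
    0 ≤ evalQuad (expandProducts lorentzProducts) u := by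
  suffices h : ∀ (N : ℕ) (u : ℕ → ℤ), (∀ f ∈ rootForms, 0 ≤ evalForm f u) → ∀ k < 13,
      ((chart k).coweight * evalForm (cuspForm k) u).toNat = N →
      0 ≤ evalQuad (expandProducts lorentzProducts) u from
    h _ u hu 0 (by norm_num) rfl
  intro N
  induction N using Nat.strong_induction_on with
  | _ N ih =>
    intro u hu k hk hN
    by_cases hc : ∀ c ∈ (chart k).neighbours, 0 ≤ evalForm (comparisonForm k c) u
    · refine evalQuad_nonneg_of_chartForms hk fun f hf => ?_
      rcases List.mem_append.1 hf with hf | hf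
      · exact hu f hf
      · obtain ⟨c, hc', rfl⟩ := List.mem_map.1 hf
        exact hc c hc'
    push Not at hc
    obtain ⟨c, hc, hlt⟩ := hc
    have hck := chart_neighbours_lt k hk c hc
    rw [comparisonForm, evalForm_addForm, evalForm_smulForm, evalForm_smulForm,
      evalForm_permuteRoots] at hlt
    rw [← evalQuad_lorentzProducts_applyWord c.2]
    have hu' := rootForms_nonneg_applyWord hu c.2
    refine ih _ ?_ _ hu' c.1 hck rfl
    have h1 : ((chart k).weight * (chart k).coweight : ℤ) = 161552160 := by
      exact_mod_cast chart_weight_mul_coweight k hk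
    have h2 : ((chart c.1).weight * (chart c.1).coweight : ℤ) = 161552160 := by
      exact_mod_cast chart_weight_mul_coweight c.1 hck
    have hφ : 0 ≤ evalForm (cuspForm c.1) (applyWord c.2 u) := evalForm_combForm_nonneg hu' _
    rw [← cuspForm] at hlt
    generalize evalForm (cuspForm c.1) (applyWord c.2 u) = y at *
    generalize evalForm (cuspForm k) u = x at *
    have hk0 : (0 : ℤ) < (chart k).coweight := by
      refine lt_of_le_of_ne (Int.natCast_nonneg _) fun h => ?_
      rw [← h] at h1
      norm_num at h1
    have hc0 : (0 : ℤ) < (chart c.1).coweight := by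
      refine lt_of_le_of_ne (Int.natCast_nonneg _) fun h => ?_
      rw [← h] at h2
      norm_num at h2
    have hmul := mul_pos hk0 hc0
    have key : (chart c.1).coweight * y < (chart k).coweight * x := by
      have h3 := mul_lt_mul_of_pos_left hlt hmul
      have h4 : 161552160 * (((chart c.1).coweight : ℤ) * y - (chart k).coweight * x) < 0 := by
        calc _ = _ := ?_
          _ < _ := h3
          _ = 0 := mul_zero _
        linear_combination (-((chart c.1).coweight : ℤ) * y) * h1 +
          ((chart k).coweight * x) * h2
      linarith
    have := mul_nonneg hc0.le hφ
    omega

theorem evalQuad_lorentzProducts (u : ℕ → ℤ) :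
    evalQuad (expandProducts lorentzProducts) u =
      lorentz (fun i : Fin 20 => u i) fun i => u i := by
  have h : ∀ i ∈ List.range 20, ∀ c : ℕ → ℤ,
      evalForm ((List.range 20).map fun j => if j = i then c j else 0) u = c i * u i := by
    intro i hi c
    rw [evalForm_map_range, Fin.sum_univ_eq_sum_range
      (fun j => (if j = i then c j else 0) * u j)]
    simpa using fun hi' => absurd (List.mem_range.1 hi) (by omega)
  rw [evalQuad_expandProducts, lorentzProducts, List.map_map]
  have : (List.range 20).map ((fun p : List ℤ × List ℤ => evalForm p.1 u * evalForm p.2 u) ∘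
      fun i => ((List.range 20).map fun j => if j = i then (if j = 0 then 1 else -1) else 0,
        (List.range 20).map fun j => if j = i then 1 else 0)) =
      (List.range 20).map fun i => (if i = 0 then 1 else -1) * (u i * u i) := by
    refine List.map_congr_left fun i hi => ?_
    simp only [Function.comp_apply, h i hi]
    ring
  rw [this]
  simp [List.range_succ, lorentz, Fin.sum_univ_succ]
  ring

end ChamberCharts

/-- A basis of the even sublattice of `ℤ^{1,19}` with Gram matrix `gramS`. -/
def evenBasis : List (List ℤ) :=
  [[9, 3, 3, 3, 3, 3, 3, 3, 3, 1, 1, 1, 1, 1, 1, 1, 1, 1, 0, 0],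
   [9, 3, 3, 3, 3, 3, 3, 3, 3, 1, 1, 1, 1, 1, 1, 1, 1, 0, 1, 0],
   [0, -1, 1, 0, 0, 0, 0, 0, 0, 0, 0, 0, 0, 0, 0, 0, 0, 0, 0, 0],
   [1, 1, 1, 1, 0, 0, 0, 0, 0, 0, 0, 0, 0, 0, 0, 0, 0, 0, 0, 0],
   [0, 0, -1, 1, 0, 0, 0, 0, 0, 0, 0, 0, 0, 0, 0, 0, 0, 0, 0, 0],
   [0, 0, 0, -1, 1, 0, 0, 0, 0, 0, 0, 0, 0, 0, 0, 0, 0, 0, 0, 0],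
   [0, 0, 0, 0, -1, 1, 0, 0, 0, 0, 0, 0, 0, 0, 0, 0, 0, 0, 0, 0],
   [0, 0, 0, 0, 0, -1, 1, 0, 0, 0, 0, 0, 0, 0, 0, 0, 0, 0, 0, 0],
   [0, 0, 0, 0, 0, 0, -1, 1, 0, 0, 0, 0, 0, 0, 0, 0, 0, 0, 0, 0],
   [0, 0, 0, 0, 0, 0, 0, -1, 1, 0, 0, 0, 0, 0, 0, 0, 0, 0, 0, 0],
   [0, 0, 0, 0, 0, 0, 0, 0, 0, -1, 1, 0, 0, 0, 0, 0, 0, 0, 0, 0],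
   [3, 1, 1, 1, 1, 1, 1, 1, 1, 1, 1, 1, 0, 0, 0, 0, 0, 0, 0, 0],
   [0, 0, 0, 0, 0, 0, 0, 0, 0, 0, -1, 1, 0, 0, 0, 0, 0, 0, 0, 0],
   [0, 0, 0, 0, 0, 0, 0, 0, 0, 0, 0, -1, 1, 0, 0, 0, 0, 0, 0, 0],
   [0, 0, 0, 0, 0, 0, 0, 0, 0, 0, 0, 0, -1, 1, 0, 0, 0, 0, 0, 0],
   [0, 0, 0, 0, 0, 0, 0, 0, 0, 0, 0, 0, 0, -1, 1, 0, 0, 0, 0, 0],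
   [0, 0, 0, 0, 0, 0, 0, 0, 0, 0, 0, 0, 0, 0, -1, 1, 0, 0, 0, 0],
   [0, 0, 0, 0, 0, 0, 0, 0, 0, 0, 0, 0, 0, 0, 0, -1, 1, 0, 0, 0],
   [9, 3, 3, 3, 3, 3, 3, 3, 3, 1, 1, 1, 1, 1, 1, 1, 1, 1, 1, -1],
   [-9, -3, -3, -3, -3, -3, -3, -3, -3, -1, -1, -1, -1, -1, -1, -1, -1, -1, -1, -1]]

/-- Twice the inverse of the matrix with columns `evenBasis`. -/
def evenBasisInverse : List (List ℤ) :=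
  [[18, -6, -6, -6, -6, -6, -6, -6, -6, -2, -2, -2, -2, -2, -2, -2, -2, 0, -2, 0],
   [18, -6, -6, -6, -6, -6, -6, -6, -6, -2, -2, -2, -2, -2, -2, -2, -2, -2, 0, 0],
   [-10, 2, 4, 4, 4, 4, 4, 4, 4, 0, 0, 0, 0, 0, 0, 0, 0, 0, 0, 0],
   [-16, 6, 6, 6, 6, 6, 6, 6, 6, 0, 0, 0, 0, 0, 0, 0, 0, 0, 0, 0],
   [-20, 6, 6, 8, 8, 8, 8, 8, 8, 0, 0, 0, 0, 0, 0, 0, 0, 0, 0, 0],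
   [-30, 10, 10, 10, 12, 12, 12, 12, 12, 0, 0, 0, 0, 0, 0, 0, 0, 0, 0, 0],
   [-24, 8, 8, 8, 8, 10, 10, 10, 10, 0, 0, 0, 0, 0, 0, 0, 0, 0, 0, 0],
   [-18, 6, 6, 6, 6, 6, 8, 8, 8, 0, 0, 0, 0, 0, 0, 0, 0, 0, 0, 0],
   [-12, 4, 4, 4, 4, 4, 4, 6, 6, 0, 0, 0, 0, 0, 0, 0, 0, 0, 0, 0],
   [-6, 2, 2, 2, 2, 2, 2, 2, 4, 0, 0, 0, 0, 0, 0, 0, 0, 0, 0, 0],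
   [-30, 10, 10, 10, 10, 10, 10, 10, 10, 2, 4, 4, 4, 4, 4, 4, 4, 0, 0, 0],
   [-48, 16, 16, 16, 16, 16, 16, 16, 16, 6, 6, 6, 6, 6, 6, 6, 6, 0, 0, 0],
   [-60, 20, 20, 20, 20, 20, 20, 20, 20, 6, 6, 8, 8, 8, 8, 8, 8, 0, 0, 0],
   [-90, 30, 30, 30, 30, 30, 30, 30, 30, 10, 10, 10, 12, 12, 12, 12, 12, 0, 0, 0],
   [-72, 24, 24, 24, 24, 24, 24, 24, 24, 8, 8, 8, 8, 10, 10, 10, 10, 0, 0, 0],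
   [-54, 18, 18, 18, 18, 18, 18, 18, 18, 6, 6, 6, 6, 6, 8, 8, 8, 0, 0, 0],
   [-36, 12, 12, 12, 12, 12, 12, 12, 12, 4, 4, 4, 4, 4, 4, 6, 6, 0, 0, 0],
   [-18, 6, 6, 6, 6, 6, 6, 6, 6, 2, 2, 2, 2, 2, 2, 2, 4, 0, 0, 0],
   [-9, 3, 3, 3, 3, 3, 3, 3, 3, 1, 1, 1, 1, 1, 1, 1, 1, 1, 1, -1],
   [9, -3, -3, -3, -3, -3, -3, -3, -3, -1, -1, -1, -1, -1, -1, -1, -1, -1, -1, -1]]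

set_option maxHeartbeats 1000000 in
/-- The coordinates in `evenBasis` of the roots proportional to `simpleRoots`. -/
def rootCoordinates : List (List ℤ) :=
  [[0, 0, 1, 0, 0, 0, 0, 0, 0, 0, 0, 0, 0, 0, 0, 0, 0, 0, 0, 0],
   [0, 0, 0, 0, 1, 0, 0, 0, 0, 0, 0, 0, 0, 0, 0, 0, 0, 0, 0, 0],
   [0, 0, 0, 0, 0, 1, 0, 0, 0, 0, 0, 0, 0, 0, 0, 0, 0, 0, 0, 0],
   [0, 0, 0, 0, 0, 0, 1, 0, 0, 0, 0, 0, 0, 0, 0, 0, 0, 0, 0, 0],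
   [0, 0, 0, 0, 0, 0, 0, 1, 0, 0, 0, 0, 0, 0, 0, 0, 0, 0, 0, 0],
   [0, 0, 0, 0, 0, 0, 0, 0, 1, 0, 0, 0, 0, 0, 0, 0, 0, 0, 0, 0],
   [0, 0, 0, 0, 0, 0, 0, 0, 0, 1, 0, 0, 0, 0, 0, 0, 0, 0, 0, 0],
   [2, 2, -2, -3, -4, -6, -5, -4, -3, -2, -4, -5, -7, -10, -8, -6, -4, -2, -1, 1],
   [0, 0, 0, 0, 0, 0, 0, 0, 0, 0, 1, 0, 0, 0, 0, 0, 0, 0, 0, 0],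
   [0, 0, 0, 0, 0, 0, 0, 0, 0, 0, 0, 0, 1, 0, 0, 0, 0, 0, 0, 0],
   [0, 0, 0, 0, 0, 0, 0, 0, 0, 0, 0, 0, 0, 1, 0, 0, 0, 0, 0, 0],
   [0, 0, 0, 0, 0, 0, 0, 0, 0, 0, 0, 0, 0, 0, 1, 0, 0, 0, 0, 0],
   [0, 0, 0, 0, 0, 0, 0, 0, 0, 0, 0, 0, 0, 0, 0, 1, 0, 0, 0, 0],
   [0, 0, 0, 0, 0, 0, 0, 0, 0, 0, 0, 0, 0, 0, 0, 0, 1, 0, 0, 0],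
   [0, 0, 0, 0, 0, 0, 0, 0, 0, 0, 0, 0, 0, 0, 0, 0, 0, 1, 0, 0],
   [1, 0, 0, 0, 0, 0, 0, 0, 0, 0, -2, -3, -4, -6, -5, -4, -3, -2, 0, 0],
   [-1, 1, 0, 0, 0, 0, 0, 0, 0, 0, 0, 0, 0, 0, 0, 0, 0, 0, 0, 0],
   [1, 0, 0, 0, 0, 0, 0, 0, 0, 0, 0, 0, 0, 0, 0, 0, 0, 0, -1, 0],
   [0, 0, 0, 0, 0, 0, 0, 0, 0, 0, 0, 0, 0, 0, 0, 0, 0, 0, 1, 1],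
   [0, 0, 0, 1, 0, 0, 0, 0, 0, 0, 0, 0, 0, 0, 0, 0, 0, 0, 0, 0],
   [0, 0, 0, 0, 0, 0, 0, 0, 0, 0, 0, 1, 0, 0, 0, 0, 0, 0, 0, 0],
   [2, 2, -4, -5, -7, -10, -8, -6, -4, -2, -2, -3, -4, -6, -5, -4, -3, -2, -1, 1],
   [3, 3, -5, -8, -10, -15, -12, -9, -6, -3, -5, -8, -10, -15, -12, -9, -6, -3, -1, 1],
   [6, 6, -8, -10, -14, -20, -16, -12, -8, -4, -10, -16, -20, -30, -24, -18, -12, -6, -3, 2],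
   [1, 0, -2, -3, -4, -6, -5, -4, -3, -2, 0, 0, 0, 0, 0, 0, 0, 0, 0, 0],
   [2, 2, -4, -5, -7, -10, -8, -6, -4, -2, -4, -5, -7, -10, -8, -6, -4, -2, -1, 0],
   [6, 6, -8, -12, -16, -24, -20, -16, -12, -6, -10, -16, -20, -30, -24, -18, -12, -6, -3, 1],
   [0, 0, 0, 0, 0, 0, 0, 0, 0, 0, 0, 0, 0, 0, 0, 0, 0, 0, 0, -1],
   [4, 4, -6, -9, -12, -18, -15, -12, -8, -4, -6, -9, -12, -18, -15, -12, -8, -4, -2, 1],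
   [8, 8, -10, -16, -20, -30, -24, -18, -12, -6, -12, -18, -24, -36, -30, -24, -16, -8, -4, 3],
   [10, 10, -14, -20, -28, -40, -32, -24, -16, -8, -16, -24, -32, -48, -40, -30, -20, -10, -5, 3],
   [6, 6, -10, -16, -20, -30, -24, -18, -12, -6, -8, -12, -16, -24, -20, -16, -12, -6, -3, 1],
   [6, 6, -8, -12, -16, -24, -20, -16, -12, -6, -8, -12, -16, -24, -20, -16, -12, -6, -3, 2],
   [8, 8, -12, -18, -24, -36, -30, -24, -16, -8, -10, -16, -20, -30, -24, -18, -12, -6, -4, 3],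
   [10, 10, -16, -24, -32, -48, -40, -30, -20, -10, -14, -20, -28, -40, -32, -24, -16, -8, -5, 3],
   [6, 6, -10, -16, -20, -30, -24, -18, -12, -6, -8, -10, -14, -20, -16, -12, -8, -4, -3, 2],
   [10, 8, -14, -20, -28, -40, -32, -24, -16, -8, -14, -20, -28, -40, -32, -24, -16, -8, -4, 3],
   [8, 8, -12, -18, -24, -36, -30, -24, -16, -8, -14, -20, -28, -40, -32, -24, -16, -8, -3, 2],
   [12, 10, -16, -24, -32, -48, -40, -30, -20, -10, -16, -24, -32, -48, -40, -30, -20, -10, -5, 4],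
   [12, 12, -16, -24, -32, -48, -40, -30, -20, -10, -20, -30, -40, -60, -48, -36, -24, -12, -6, 3],
   [10, 10, -16, -22, -30, -44, -36, -28, -20, -10, -16, -24, -32, -48, -40, -30, -20, -10, -4, 3],
   [10, 10, -14, -22, -28, -42, -34, -26, -18, -10, -16, -24, -32, -48, -40, -30, -20, -10, -5, 2],
   [8, 8, -14, -20, -28, -40, -32, -24, -16, -8, -12, -18, -24, -36, -30, -24, -16, -8, -3, 2],
   [12, 12, -18, -26, -36, -52, -42, -32, -22, -12, -18, -28, -36, -54, -44, -34, -24, -12, -6, 3],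
   [10, 10, -16, -24, -32, -48, -40, -30, -20, -10, -16, -22, -30, -44, -36, -28, -20, -10, -4, 3],
   [10, 10, -16, -24, -32, -48, -40, -30, -20, -10, -14, -22, -28, -42, -34, -26, -18, -10, -5, 2],
   [14, 14, -20, -30, -40, -60, -48, -36, -24, -12, -22, -32, -44, -64, -52, -40, -28, -14, -7, 4],
   [12, 12, -18, -28, -36, -54, -44, -34, -24, -12, -18, -26, -36, -52, -42, -32, -22, -12, -6, 3],
   [14, 14, -22, -32, -44, -64, -52, -40, -28, -14, -20, -30, -40, -60, -48, -36, -24, -12, -7, 4],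
   [12, 12, -20, -30, -40, -60, -48, -36, -24, -12, -16, -24, -32, -48, -40, -30, -20, -10, -6, 3]]

/-- The coordinates in `evenBasis` of a vector in the interior of the chamber. -/
def interiorCoordinates : List ℤ :=
  [62, 60, -92, -136, -182, -270, -220, -168, -114, -58, -92, -136, -182, -270, -220, -168, -114,
   -58, -29, 17]

section EvenLattice

/-- The vector with coordinate list `l`. -/
def listVec {n : ℕ} (l : List ℤ) : Fin n → ℤ := fun i => l.getD i 0

/-- The embedding of the lattice with Gram matrix `gramS` into `ℤ^{1,19}`. -/
def evenEmbedding : Matrix (Fin (19 + 1)) (Fin (2 + (8 + (8 + (1 + 1))))) ℤ :=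
  Matrix.of fun i j => (evenBasis.getD j []).getD i 0

theorem bform_eq_lorentz_of_col {n m : ℕ} {G : Matrix (Fin n) (Fin n) ℤ}
    {E : Matrix (Fin (m + 1)) (Fin n) ℤ} (h : G = Matrix.of fun i j => lorentz (E.col i) (E.col j))
    (x y : Fin n → ℤ) : bform G x y = lorentz (E *ᵥ x) (E *ᵥ y) := by
  let d : Fin (m + 1) → ℤ := Fin.cons 1 fun _ => -1
  have hd : ∀ u v : Fin (m + 1) → ℤ, lorentz u v = u ⬝ᵥ (Matrix.diagonal d *ᵥ v) := by
    intro u v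
    simp [lorentz, dotProduct, Matrix.mulVec_diagonal, Fin.sum_univ_succ, d, sub_eq_add_neg]
  have hG : G = Eᵀ * (Matrix.diagonal d * E) := by
    ext i j
    rw [h, Matrix.of_apply, hd, Matrix.mul_apply]
    simp [dotProduct, Matrix.mulVec_diagonal]
  rw [hd, bform, hG, ← Matrix.mulVec_mulVec, ← Matrix.mulVec_mulVec, Matrix.dotProduct_mulVec,
    Matrix.vecMul_transpose]

theorem gramS_eq_lorentz :
    gramS = Matrix.of fun i j => lorentz (evenEmbedding.col i) (evenEmbedding.col j) := by
  decide +kernel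

/-- Twice a left inverse of `evenEmbedding`. -/
def evenRetraction : Matrix (Fin (2 + (8 + (8 + (1 + 1))))) (Fin (19 + 1)) ℤ :=
  Matrix.of fun i j => (evenBasisInverse.getD i []).getD j 0

theorem evenRetraction_mul_evenEmbedding : evenRetraction * evenEmbedding = 2 := by
  decide +kernel

theorem evenEmbedding_injective : Function.Injective (evenEmbedding *ᵥ ·) := by
  intro x y h
  have h2 := congrArg (evenRetraction *ᵥ ·) h
  simp only [Matrix.mulVec_mulVec, evenRetraction_mul_evenEmbedding] at h2
  funext i
  simpa [Matrix.ofNat_mulVec] using congrFun h2 i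

/-- The simple roots, up to multiples, in the coordinates of `gramS`. -/
def latticeRoot (i : Fin 50) : Fin (2 + (8 + (8 + (1 + 1)))) → ℤ :=
  listVec (rootCoordinates.getD i [])

/-- The simple roots as vectors. -/
def simpleRoot (i : Fin 50) : Fin (19 + 1) → ℤ := listVec (simpleRoots.getD i [])

theorem evenEmbedding_latticeRoot : ∀ i,
    (lorentz (simpleRoot i) (simpleRoot i) = -2 ∧
      evenEmbedding *ᵥ latticeRoot i = simpleRoot i) ∨
    (lorentz (simpleRoot i) (simpleRoot i) = -1 ∧
      evenEmbedding *ᵥ latticeRoot i = (2 : ℤ) • simpleRoot i) := by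
  decide +kernel

theorem lorentz_smul_left {m : ℕ} (c : ℤ) (u v : Fin (m + 1) → ℤ) :
    lorentz (c • u) v = c * lorentz u v := by
  simp only [lorentz, Pi.smul_apply, smul_eq_mul, mul_sub, Finset.mul_sum, mul_assoc]

theorem isRoot_latticeRoot (i : Fin 50) : IsRoot gramS (latticeRoot i) := by
  have hG := bform_eq_lorentz_of_col gramS_eq_lorentz
  rcases evenEmbedding_latticeRoot i with ⟨h, he⟩ | ⟨h, he⟩
  · exact Or.inl (by rw [hG, he, h])
  · refine Or.inr ⟨?_, fun x => ?_⟩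
    · rw [hG, he, lorentz_smul_left, lorentz_comm, lorentz_smul_left, h]; norm_num
    · rw [hG, he, lorentz_smul_left]
      exact dvd_mul_right _ _

/-- The linear forms of the simple roots are nonnegative on the chamber of the lattice roots. -/
theorem lorentz_simpleRoot_nonneg {y : Fin (2 + (8 + (8 + (1 + 1)))) → ℤ}
    (hy : ∀ i, 0 ≤ bform gramS (latticeRoot i) y) (i : Fin 50) :
    0 ≤ lorentz (simpleRoot i) (evenEmbedding *ᵥ y) := by
  have h := hy i
  rw [bform_eq_lorentz_of_col gramS_eq_lorentz] at h
  rcases evenEmbedding_latticeRoot i with ⟨-, he⟩ | ⟨-, he⟩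
  · rwa [he] at h
  · rw [he, lorentz_smul_left] at h
    linarith

theorem bform_nonneg_of_latticeRoot (y : Fin (2 + (8 + (8 + (1 + 1)))) → ℤ)
    (hy : ∀ i, 0 ≤ bform gramS (latticeRoot i) y) : 0 ≤ bform gramS y y := by
  set v := evenEmbedding *ᵥ y with hv
  let u : ℕ → ℤ := fun i => v (Fin.ofNat 20 i)
  have huv : (fun i : Fin 20 => u i) = v := funext fun i => by simp [u]
  rw [bform_eq_lorentz_of_col gramS_eq_lorentz, ← hv, ← huv, ← evalQuad_lorentzProducts]
  refine evalQuad_nonneg_of_rootForms fun f hf => ?_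
  obtain ⟨r, hr, rfl⟩ := List.mem_map.1 hf
  have hlen : ∀ r ∈ simpleRoots, r.length = 19 + 1 := by decide +kernel
  rw [evalForm_lorentzForm r (hlen r hr)]
  obtain ⟨i, hi, rfl⟩ := List.getElem_of_mem hr
  have hcard : simpleRoots.length = 50 := by decide +kernel
  have h := lorentz_simpleRoot_nonneg hy ⟨i, hcard ▸ hi⟩
  rw [← hv, ← huv] at h
  have hr : simpleRoot ⟨i, hcard ▸ hi⟩ = fun j : Fin (19 + 1) => simpleRoots[i].getD j 0 :=
    funext fun j => by simp [simpleRoot, listVec, hi]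
  rwa [hr] at h

end EvenLattice

/-- The lattice `U ⊕ E₈ ⊕ E₈ ⊕ A₁ ⊕ A₁` is reflective: the subgroup `W_r` of `O(S)`
generated by the reflections in all roots has finite index in `O(S)`. -/
theorem reflective_20_2_1 : (Wr _ gramS).FiniteIndex := by
  have hG := bform_eq_lorentz_of_col gramS_eq_lorentz
  have hρ : 0 < bform gramS (listVec interiorCoordinates) (listVec interiorCoordinates) ∧
      ∀ i, 0 < bform gramS (latticeRoot i) (listVec interiorCoordinates) := by
    simp only [hG]
    decide +kernel
  exact finiteIndex_Wr hG evenEmbedding_injective isRoot_latticeRoot hρ.1 hρ.2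
    bform_nonneg_of_latticeRoot
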